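/- For each n ≥ 1 let 𝓘_n denote the (finite, nonempty) set of pairs (F, J) where F is an acyclic simple graph (forest) on the vertex set Fin n and J is a maximal independent set of F, let i_n = |𝓘_n|, and let E_n = (Σ_{(F,J) ∈ 𝓘_n} |J|) / i_n be the expected size of a uniformly random element of 𝓘_n. Then there exist real constants μ > 0 and K ≥ 0 such that |E_n − μ·n| ≤ K for all n ≥ 1. -/

import Mathlib

open Filter Topology MeasureTheory

/-- `J` is an independent set of the simple graph `G`. -/
def IsIndepSet {V : Type*} (G : SimpleGraph V) (J : Set V) : Prop :=
  ∀ ⦃u v : V⦄, u ∈ J → v ∈ J → ¬ G.Adj u v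

/-- `J` is a maximal independent set of `G`. -/
def IsMaximalIndepSet {V : Type*} (G : SimpleGraph V) (J : Set V) : Prop :=
  IsIndepSet G J ∧ ∀ J' : Set V, IsIndepSet G J' → ¬ J ⊂ J'

/-- The pairs `(F, J)` where `F` is a forest (acyclic simple graph) on `Fin n`
and `J` is a maximal independent set of `F`. -/
def MISpace (n : ℕ) :=
  {p : SimpleGraph (Fin n) × Set (Fin n) // p.1.IsAcyclic ∧ IsMaximalIndepSet p.1 p.2}

/-- `iN n` is the number of pairs `(F, J)` where `F` is a forest on `Fin n`
and `J` is a maximal independent set of `F`. -/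
noncomputable def iN (n : ℕ) : ℕ := Nat.card (MISpace n)

/-- The expected size of a uniformly random maximal independent set–forest
pair on `n` vertices: the arithmetic mean of `|J|` over all pairs `(F, J)`. -/
noncomputable def En (n : ℕ) : ℝ :=
  (∑ᶠ p : MISpace n, (p.val.2.ncard : ℝ)) / (iN n : ℝ)

section

namespace SimpleGraph
variable {V : Type*}

/-- The spanning subgraph of `G` that keeps the edges inside `K`. -/
def within (G : SimpleGraph V) (K : Set V) : SimpleGraph V where
  Adj u v := G.Adj u v ∧ u ∈ K ∧ v ∈ K
  symm := ⟨fun _ _ h => ⟨h.1.symm, h.2.2, h.2.1⟩⟩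
  loopless := ⟨fun _ h => G.loopless.irrefl _ h.1⟩

theorem within_le (G : SimpleGraph V) (K : Set V) : G.within K ≤ G := fun _ _ h => h.1

theorem Reachable.mem_and_reachable {G H : SimpleGraph V} {K : Set V}
    (h : ∀ u v, u ∈ K → G.Adj u v → v ∈ K ∧ H.Adj u v) {u v : V} (hu : u ∈ K)
    (huv : G.Reachable u v) : v ∈ K ∧ H.Reachable u v := by
  obtain ⟨p⟩ := huv
  induction p with
  | nil => exact ⟨hu, .rfl⟩
  | cons hadj _ ih =>
    obtain ⟨h1, h2⟩ := h _ _ hu hadj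
    exact ⟨(ih h1).1, h2.reachable.trans (ih h1).2⟩

theorem IsAcyclic.sup_of_separated {G₁ G₂ : SimpleGraph V} {K : Set V}
    (h₁ : ∀ u v, G₁.Adj u v → u ∉ K) (h₂ : ∀ u v, G₂.Adj u v → u ∈ K)
    (a₁ : G₁.IsAcyclic) (a₂ : G₂.IsAcyclic) : (G₁ ⊔ G₂).IsAcyclic := by
  rw [isAcyclic_iff_forall_adj_isBridge] at *
  intro v w hvw
  rcases hvw with hvw | hvw
  · rw [isBridge_iff]
    intro hr
    refine (isBridge_iff.1 (a₁ hvw)) (Reachable.mem_and_reachable (K := Kᶜ) ?_ (h₁ _ _ hvw) hr).2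
    intro x y hx hxy
    rw [deleteEdges_adj] at hxy
    obtain ⟨hxy | hxy, hne⟩ := hxy
    · exact ⟨h₁ _ _ hxy.symm, deleteEdges_adj.2 ⟨hxy, hne⟩⟩
    · exact absurd (h₂ _ _ hxy) hx
  · rw [isBridge_iff]
    intro hr
    refine (isBridge_iff.1 (a₂ hvw)) (Reachable.mem_and_reachable (K := K) ?_ (h₂ _ _ hvw) hr).2
    intro x y hx hxy
    rw [deleteEdges_adj] at hxy
    obtain ⟨hxy | hxy, hne⟩ := hxy
    · exact absurd hx (h₁ _ _ hxy)
    · exact ⟨h₂ _ _ hxy.symm, deleteEdges_adj.2 ⟨hxy, hne⟩⟩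

/-- The first edge of a path from `r` to `v`. -/
theorem Reachable.exists_adj_deleteEdges {G : SimpleGraph V} {r v : V} (h : G.Reachable r v)
    (hne : r ≠ v) : ∃ c, G.Adj r c ∧ (G.deleteEdges {s(r, c)}).Reachable c v := by
  classical
  obtain ⟨p, hp⟩ := h.exists_isPath
  cases p with
  | nil => exact absurd rfl hne
  | @cons _ c _ hadj q =>
    rw [Walk.cons_isPath_iff] at hp
    refine ⟨c, hadj, ⟨q.toDeleteEdges _ ?_⟩⟩
    intro e he hmem
    rw [Set.mem_singleton_iff] at hmem
    subst hmem
    exact hp.2 (q.fst_mem_support_of_mem_edges he)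

theorem Reachable.deleteEdges_or {G : SimpleGraph V} {r c x : V} (h : G.Reachable r x) :
    (G.deleteEdges {s(r, c)}).Reachable r x ∨ (G.deleteEdges {s(r, c)}).Reachable c x := by
  obtain ⟨p⟩ := h.symm
  induction p with
  | nil => exact Or.inl .rfl
  | @cons a b d hab q ih =>
    specialize ih ⟨q.reverse⟩
    by_cases he : s(a, b) = s(d, c)
    · rw [Sym2.eq_iff] at he
      rcases he with ⟨rfl, rfl⟩ | ⟨rfl, rfl⟩
      · exact Or.inl .rfl
      · exact Or.inr .rfl
    · have : (G.deleteEdges {s(d, c)}).Adj b a :=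
        deleteEdges_adj.2 ⟨hab.symm, by rw [Set.mem_singleton_iff, Sym2.eq_swap]; exact he⟩
      exact ih.imp (·.trans this.reachable) (·.trans this.reachable)

end SimpleGraph

end

section

/-- `x` has a neighbour in `J`. -/
def IsDominated (G : SimpleGraph ℕ) (J : Set ℕ) (x : ℕ) : Prop := ∃ y ∈ J, G.Adj x y

/-- A forest with vertices in `S` together with an independent subset of `S`. -/
structure IsMarkedForest (S : Finset ℕ) (G : SimpleGraph ℕ) (J : Set ℕ) : Prop where
  mem : ∀ u v, G.Adj u v → u ∈ S
  sub : ∀ u ∈ J, u ∈ S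
  indep : ∀ u v, u ∈ J → v ∈ J → ¬ G.Adj u v
  acyclic : G.IsAcyclic

/-- Trees on `S` rooted at `r` with an independent set dominating all vertices except possibly `r`,
where the status of `r` (membership in the set, domination) is restricted by `X`. -/
def treeConf (X : Prop → Prop → Prop) (S : Finset ℕ) (r : ℕ) : Set (SimpleGraph ℕ × Set ℕ) :=
  {p | IsMarkedForest S p.1 p.2 ∧ (∀ x ∈ S, p.1.Reachable r x) ∧
    (∀ x ∈ S, x ≠ r → x ∈ p.2 ∨ IsDominated p.1 p.2 x) ∧ X (r ∈ p.2) (IsDominated p.1 p.2 r)}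

/-- Forests on `S` with a maximal independent set. -/
def forestConf (S : Finset ℕ) : Set (SimpleGraph ℕ × Set ℕ) :=
  {p | IsMarkedForest S p.1 p.2 ∧ ∀ x ∈ S, x ∈ p.2 ∨ IsDominated p.1 p.2 x}

theorem finite_isMarkedForest (S : Finset ℕ) :
    {p : SimpleGraph ℕ × Set ℕ | IsMarkedForest S p.1 p.2}.Finite := by
  refine Set.Finite.of_finite_image (f := fun p => ({e : ℕ × ℕ | p.1.Adj e.1 e.2}, p.2)) ?_ ?_
  · refine Set.Finite.subset (((S ×ˢ S).finite_toSet.powerset).prod S.finite_toSet.powerset) ?_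
    rintro _ ⟨p, hp, rfl⟩
    refine ⟨fun e he => ?_, fun u hu => hp.sub u hu⟩
    simp only [Finset.coe_product, Set.mem_prod]
    exact ⟨hp.mem _ _ he, hp.mem _ _ (SimpleGraph.Adj.symm he)⟩
  · rintro ⟨G, J⟩ - ⟨G', J'⟩ - h
    simp only [Prod.mk.injEq] at h
    refine Prod.ext ?_ h.2
    ext u v
    exact Set.ext_iff.1 h.1 (u, v)

theorem finite_treeConf (X : Prop → Prop → Prop) (S : Finset ℕ) (r : ℕ) : (treeConf X S r).Finite :=
  (finite_isMarkedForest S).subset fun _ h => h.1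

theorem finite_forestConf (S : Finset ℕ) : (forestConf S).Finite :=
  (finite_isMarkedForest S).subset fun _ h => h.1

theorem Set.ncard_eq_sum_mul {ι α β γ : Type*} (s : Finset ι) (P : ι → Set α) (Q : ι → Set β)
    (R : Set γ) (f : ι → α → β → γ) (hP : ∀ i, (P i).Finite) (hQ : ∀ i, (Q i).Finite)
    (maps : ∀ i ∈ s, ∀ a ∈ P i, ∀ b ∈ Q i, f i a b ∈ R)
    (inj : ∀ i ∈ s, ∀ a ∈ P i, ∀ b ∈ Q i, ∀ i' ∈ s, ∀ a' ∈ P i', ∀ b' ∈ Q i',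
      f i a b = f i' a' b' → i = i' ∧ a = a' ∧ b = b')
    (surj : ∀ g ∈ R, ∃ i ∈ s, ∃ a ∈ P i, ∃ b ∈ Q i, f i a b = g) :
    R.ncard = ∑ i ∈ s, (P i).ncard * (Q i).ncard := by
  classical
  let D := s.sigma fun i => (hP i).toFinset ×ˢ (hQ i).toFinset
  have hR : R = ↑(D.image fun x => f x.1 x.2.1 x.2.2) := by
    ext g
    simp only [D, Finset.coe_image, Set.mem_image, Finset.mem_coe, Finset.mem_sigma,
      Finset.mem_product, Set.Finite.mem_toFinset]
    constructor
    · intro hg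
      obtain ⟨i, hi, a, ha, b, hb, rfl⟩ := surj g hg
      exact ⟨⟨i, a, b⟩, ⟨hi, ha, hb⟩, rfl⟩
    · rintro ⟨⟨i, a, b⟩, ⟨hi, ha, hb⟩, rfl⟩
      exact maps i hi a ha b hb
  rw [hR, Set.ncard_coe_finset, Finset.card_image_of_injOn, Finset.card_sigma]
  · refine Finset.sum_congr rfl fun i _ => ?_
    rw [Finset.card_product, Set.ncard_eq_toFinset_card _ (hP i),
      Set.ncard_eq_toFinset_card _ (hQ i)]
  · rintro ⟨i, a, b⟩ h ⟨i', a', b'⟩ h' heq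
    simp only [D, Finset.coe_sigma, Set.mem_sigma_iff, Finset.mem_coe, Finset.mem_product,
      Set.Finite.mem_toFinset] at h h'
    obtain ⟨rfl, rfl, rfl⟩ := inj i h.1 a h.2.1 b h.2.2 i' h'.1 a' h'.2.1 b' h'.2.2 heq
    rfl

namespace IsMarkedForest
open SimpleGraph

variable {S L K : Finset ℕ} {G G₁ G₂ : SimpleGraph ℕ} {J J₁ J₂ : Set ℕ} {r c : ℕ}

theorem within (h : IsMarkedForest S G J) (K : Finset ℕ) :
    IsMarkedForest K (G.within K) (J ∩ K) where
  mem _ _ huv := huv.2.1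
  sub _ hu := hu.2
  indep u v hu hv huv := h.indep u v hu.1 hv.1 huv.1
  acyclic := h.acyclic.anti (within_le _ _)

theorem sup (h₁ : IsMarkedForest L G₁ J₁) (h₂ : IsMarkedForest K G₂ J₂) (hd : Disjoint L K) :
    IsMarkedForest (L ∪ K) (G₁ ⊔ G₂) (J₁ ∪ J₂) where
  mem u v huv := Finset.mem_union.2 (huv.imp (h₁.mem u v) (h₂.mem u v))
  sub u hu := Finset.mem_union.2 (hu.imp (h₁.sub u) (h₂.sub u))
  indep u v hu hv huv := by
    have hd' := Finset.disjoint_left.1 hd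
    rcases huv with huv | huv
    · have a := h₁.mem _ _ huv
      have b := h₁.mem _ _ huv.symm
      rcases hu with hu | hu
      · rcases hv with hv | hv
        · exact h₁.indep u v hu hv huv
        · exact hd' b (h₂.sub _ hv)
      · exact hd' a (h₂.sub _ hu)
    · have a := h₂.mem _ _ huv
      have b := h₂.mem _ _ huv.symm
      rcases hu with hu | hu
      · exact hd' (h₁.sub _ hu) a
      · rcases hv with hv | hv
        · exact hd' (h₁.sub _ hv) b
        · exact h₂.indep u v hu hv huv
  acyclic := IsAcyclic.sup_of_separated (K := K)
    (fun u v huv => by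
      have := Finset.disjoint_left.1 hd (h₁.mem _ _ huv)
      exact_mod_cast this)
    (fun u v huv => by exact_mod_cast h₂.mem _ _ huv) h₁.acyclic h₂.acyclic

theorem sup_edge (h : IsMarkedForest S G J) (hr : r ∈ S) (hc : c ∈ S) (hrc : ¬ G.Reachable r c)
    (hJ : ¬ (r ∈ J ∧ c ∈ J)) : IsMarkedForest S (G ⊔ edge r c) J where
  mem u v huv := by
    rcases huv with huv | huv
    · exact h.mem _ _ huv
    · rw [edge_adj] at huv
      rcases huv.1 with ⟨rfl, -⟩ | ⟨rfl, -⟩ <;> assumption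
  sub := h.sub
  indep u v hu hv huv := by
    rcases huv with huv | huv
    · exact h.indep _ _ hu hv huv
    · rw [edge_adj] at huv
      rcases huv.1 with ⟨rfl, rfl⟩ | ⟨rfl, rfl⟩
      · exact hJ ⟨hu, hv⟩
      · exact hJ ⟨hv, hu⟩
  acyclic := h.acyclic.sup_edge_of_not_reachable hrc

section glue
set_option linter.unusedSectionVars false
variable (h₁ : IsMarkedForest L G₁ J₁) (h₂ : IsMarkedForest K G₂ J₂) (hd : Disjoint L K)
include h₁ h₂ hd

theorem mem_union_left {x : ℕ} (hx : x ∈ L) : x ∈ J₁ ∪ J₂ ↔ x ∈ J₁ :=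
  or_iff_left fun h => Finset.disjoint_left.1 hd hx (h₂.sub _ h)

theorem mem_union_right {x : ℕ} (hx : x ∈ K) : x ∈ J₁ ∪ J₂ ↔ x ∈ J₂ :=
  or_iff_right fun h => Finset.disjoint_left.1 hd (h₁.sub _ h) hx

theorem sup_adj_left {x y : ℕ} (hx : x ∈ L) : (G₁ ⊔ G₂).Adj x y ↔ G₁.Adj x y :=
  or_iff_left fun h => Finset.disjoint_left.1 hd hx (h₂.mem _ _ h)

theorem sup_adj_right {x y : ℕ} (hx : x ∈ K) : (G₁ ⊔ G₂).Adj x y ↔ G₂.Adj x y :=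
  or_iff_right fun h => Finset.disjoint_left.1 hd (h₁.mem _ _ h) hx

theorem isDominated_sup_left {x : ℕ} (hx : x ∈ L) :
    IsDominated (G₁ ⊔ G₂) (J₁ ∪ J₂) x ↔ IsDominated G₁ J₁ x := by
  refine exists_congr fun y => ?_
  rw [sup_adj_left h₁ h₂ hd hx]
  exact and_congr_left fun hy => mem_union_left h₁ h₂ hd (h₁.mem _ _ hy.symm)

theorem isDominated_sup_right {x : ℕ} (hx : x ∈ K) :
    IsDominated (G₁ ⊔ G₂) (J₁ ∪ J₂) x ↔ IsDominated G₂ J₂ x := by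
  refine exists_congr fun y => ?_
  rw [sup_adj_right h₁ h₂ hd hx]
  exact and_congr_left fun hy => mem_union_right h₁ h₂ hd (h₂.mem _ _ hy.symm)

variable (hr : r ∈ L) (hc : c ∈ K)
include hr hc

theorem edge_adj_left {x y : ℕ} (hx : x ∈ L) : (edge r c).Adj x y ↔ x = r ∧ y = c := by
  have := Finset.disjoint_left.1 hd
  rw [edge_adj]
  constructor
  · rintro ⟨h | ⟨rfl, rfl⟩, -⟩
    · exact h
    · exact absurd hc (this hx)
  · rintro ⟨rfl, rfl⟩
    exact ⟨Or.inl ⟨rfl, rfl⟩, fun h => this hx (h ▸ hc)⟩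

theorem edge_adj_right {x y : ℕ} (hx : x ∈ K) : (edge r c).Adj x y ↔ x = c ∧ y = r := by
  rw [edge_comm]
  exact edge_adj_left h₂ h₁ hd.symm hc hr hx

theorem isDominated_glue_left {x : ℕ} (hx : x ∈ L) :
    IsDominated (G₁ ⊔ G₂ ⊔ edge r c) (J₁ ∪ J₂) x ↔ IsDominated G₁ J₁ x ∨ (x = r ∧ c ∈ J₂) := by
  rw [← isDominated_sup_left h₁ h₂ hd hx, ← mem_union_right h₁ h₂ hd hc]
  simp only [IsDominated, sup_adj (G₁ ⊔ G₂), edge_adj_left h₁ h₂ hd hr hc hx]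
  grind

theorem isDominated_glue_right {x : ℕ} (hx : x ∈ K) :
    IsDominated (G₁ ⊔ G₂ ⊔ edge r c) (J₁ ∪ J₂) x ↔ IsDominated G₂ J₂ x ∨ (x = c ∧ r ∈ J₁) := by
  rw [← isDominated_sup_right h₁ h₂ hd hx, ← mem_union_left h₁ h₂ hd hr]
  simp only [IsDominated, sup_adj (G₁ ⊔ G₂), edge_adj_right h₁ h₂ hd hr hc hx]
  grind

theorem not_reachable_sup : ¬ (G₁ ⊔ G₂).Reachable r c := by
  intro h
  have := (Reachable.mem_and_reachable (G := G₁ ⊔ G₂) (H := G₁ ⊔ G₂) (K := L)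
    (fun u v hu huv => ⟨?_, huv⟩) hr h).1
  · exact Finset.disjoint_left.1 hd this hc
  · exact h₁.mem _ _ ((sup_adj_left h₁ h₂ hd hu).1 huv).symm

end glue
end IsMarkedForest

end

section

namespace IsMarkedForest
open SimpleGraph

variable {S L K L' K' : Finset ℕ} {G G₁ G₂ G₁' G₂' : SimpleGraph ℕ} {J J₁ J₂ : Set ℕ} {r c c' v : ℕ}

theorem sup_comm_edge (h₁ : IsMarkedForest L G₁ J₁) (h₂ : IsMarkedForest K G₂ J₂)
    (hd : Disjoint L K) (hr : r ∈ L) (hc : c ∈ K) (hJ : ¬ (r ∈ J₁ ∧ c ∈ J₂)) :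
    IsMarkedForest (L ∪ K) (G₁ ⊔ G₂ ⊔ edge r c) (J₁ ∪ J₂) := by
  refine (h₁.sup h₂ hd).sup_edge (Finset.mem_union_left _ hr) (Finset.mem_union_right _ hc)
    (not_reachable_sup h₁ h₂ hd hr hc) ?_
  rwa [mem_union_left h₁ h₂ hd hr, mem_union_right h₁ h₂ hd hc]

theorem glue_mem_treeConf_iff {X Y : Prop → Prop → Prop}
    (hXY : ∀ j₁ d₁ j₂ d₂ : Prop, (X j₁ (d₁ ∨ j₂) ∧ ¬ (j₁ ∧ j₂) ∧ (j₂ ∨ j₁ ∨ d₂)) ↔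
      X j₁ d₁ ∧ Y j₂ d₂)
    (h₁ : IsMarkedForest L G₁ J₁) (h₂ : IsMarkedForest K G₂ J₂)
    (hd : Disjoint L K) (hr : r ∈ L) (hc : c ∈ K) (c₁ : ∀ x ∈ L, G₁.Reachable r x)
    (c₂ : ∀ x ∈ K, G₂.Reachable c x) :
    (G₁ ⊔ G₂ ⊔ edge r c, J₁ ∪ J₂) ∈ treeConf X (L ∪ K) r ↔
      (G₁, J₁) ∈ treeConf X L r ∧ (G₂, J₂) ∈ treeConf Y K c := by
  have hdis := Finset.disjoint_left.1 hd
  have hrc : r ≠ c := fun h => hdis hr (h ▸ hc)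
  have key := hXY (r ∈ J₁) (IsDominated G₁ J₁ r) (c ∈ J₂) (IsDominated G₂ J₂ c)
  have hXr : X (r ∈ J₁ ∪ J₂) (IsDominated (G₁ ⊔ G₂ ⊔ edge r c) (J₁ ∪ J₂) r) ↔
      X (r ∈ J₁) (IsDominated G₁ J₁ r ∨ c ∈ J₂) := by
    rw [mem_union_left h₁ h₂ hd hr, isDominated_glue_left h₁ h₂ hd hr hc hr]
    simp
  constructor
  · rintro ⟨hF, -, hdom, hX⟩
    have hnot : ¬ (r ∈ J₁ ∧ c ∈ J₂) := fun h => by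
      refine hF.indep r c (Or.inl h.1) (Or.inr h.2) ?_
      exact Or.inr ((edge_adj ..).2 ⟨Or.inl ⟨rfl, rfl⟩, hrc⟩)
    have hdc := hdom c (Finset.mem_union_right _ hc) hrc.symm
    rw [mem_union_right h₁ h₂ hd hc, isDominated_glue_right h₁ h₂ hd hr hc hc] at hdc
    obtain ⟨k₁, k₂⟩ := key.1 ⟨hXr.1 hX, hnot,
      hdc.imp_right fun h => h.elim Or.inr fun h => Or.inl h.2⟩
    refine ⟨⟨h₁, c₁, fun x hx hxr => ?_, k₁⟩, ⟨h₂, c₂, fun x hx hxc => ?_, k₂⟩⟩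
    · have := hdom x (Finset.mem_union_left _ hx) hxr
      rw [mem_union_left h₁ h₂ hd hx, isDominated_glue_left h₁ h₂ hd hr hc hx] at this
      exact this.imp_right fun h => h.resolve_right fun h => hxr h.1
    · have := hdom x (Finset.mem_union_right _ hx) (fun h => hdis hr (h ▸ hx))
      rw [mem_union_right h₁ h₂ hd hx, isDominated_glue_right h₁ h₂ hd hr hc hx] at this
      exact this.imp_right fun h => h.resolve_right fun h => hxc h.1
  · rintro ⟨⟨-, -, d₁, x₁⟩, ⟨-, -, d₂, x₂⟩⟩
    obtain ⟨hX, hnot, hdc⟩ := key.2 ⟨x₁, x₂⟩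
    refine ⟨sup_comm_edge h₁ h₂ hd hr hc hnot, fun x hx => ?_, fun x hx hxr => ?_, hXr.2 hX⟩
    · rcases Finset.mem_union.1 hx with hx | hx
      · exact (c₁ x hx).mono (le_sup_left.trans le_sup_left)
      · refine (Adj.reachable (v := c) ?_).trans ((c₂ x hx).mono (le_sup_right.trans le_sup_left))
        exact Or.inr ((edge_adj ..).2 ⟨Or.inl ⟨rfl, rfl⟩, hrc⟩)
    · rcases Finset.mem_union.1 hx with hx | hx
      · rw [mem_union_left h₁ h₂ hd hx, isDominated_glue_left h₁ h₂ hd hr hc hx]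
        exact (d₁ x hx hxr).imp_right Or.inl
      · rw [mem_union_right h₁ h₂ hd hx, isDominated_glue_right h₁ h₂ hd hr hc hx]
        by_cases hxc : x = c
        · subst hxc
          exact hdc.imp_right fun h => h.elim (fun h => Or.inr ⟨rfl, h⟩) Or.inl
        · exact (d₂ x hx hxc).imp_right Or.inl

theorem sup_mem_forestConf_iff {Y : Prop → Prop → Prop} (hY : ∀ j d, Y j d → j ∨ d)
    (h₁ : IsMarkedForest L G₁ J₁) (h₂ : IsMarkedForest K G₂ J₂)
    (hd : Disjoint L K) (hc : c ∈ K) (c₂ : ∀ x ∈ K, G₂.Reachable c x) :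
    (G₁ ⊔ G₂, J₁ ∪ J₂) ∈ {p ∈ forestConf (L ∪ K) | Y (c ∈ p.2) (IsDominated p.1 p.2 c)} ↔
      (G₁, J₁) ∈ forestConf L ∧ (G₂, J₂) ∈ treeConf Y K c := by
  have hYc : Y (c ∈ J₁ ∪ J₂) (IsDominated (G₁ ⊔ G₂) (J₁ ∪ J₂) c) ↔
      Y (c ∈ J₂) (IsDominated G₂ J₂ c) := by
    rw [mem_union_right h₁ h₂ hd hc, isDominated_sup_right h₁ h₂ hd hc]
  constructor
  · rintro ⟨⟨-, hdom⟩, hX⟩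
    refine ⟨⟨h₁, fun x hx => ?_⟩, ⟨h₂, c₂, fun x hx _ => ?_, hYc.1 hX⟩⟩
    · have := hdom x (Finset.mem_union_left _ hx)
      rwa [mem_union_left h₁ h₂ hd hx, isDominated_sup_left h₁ h₂ hd hx] at this
    · have := hdom x (Finset.mem_union_right _ hx)
      rwa [mem_union_right h₁ h₂ hd hx, isDominated_sup_right h₁ h₂ hd hx] at this
  · rintro ⟨⟨-, d₁⟩, ⟨-, -, d₂, x₂⟩⟩
    refine ⟨⟨h₁.sup h₂ hd, fun x hx => ?_⟩, hYc.2 x₂⟩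
    rcases Finset.mem_union.1 hx with hx | hx
    · rw [mem_union_left h₁ h₂ hd hx, isDominated_sup_left h₁ h₂ hd hx]
      exact d₁ x hx
    · rw [mem_union_right h₁ h₂ hd hx, isDominated_sup_right h₁ h₂ hd hx]
      by_cases hxc : x = c
      · subst hxc; exact hY _ _ x₂
      · exact d₂ x hx hxc

section injectivity
variable {J₁' J₂' : Set ℕ}

theorem inter_left_eq (h₁ : IsMarkedForest L G₁ J₁) (h₂ : IsMarkedForest K G₂ J₂)
    (hd : Disjoint L K) : (J₁ ∪ J₂) ∩ L = J₁ := by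
  ext x
  constructor
  · rintro ⟨hx, hxL⟩
    exact (mem_union_left h₁ h₂ hd hxL).1 hx
  · exact fun hx => ⟨Or.inl hx, h₁.sub x hx⟩

theorem within_left_eq (h₁ : IsMarkedForest L G₁ J₁) (h₂ : IsMarkedForest K G₂ J₂)
    (hd : Disjoint L K) : (G₁ ⊔ G₂).within L = G₁ := by
  ext x y
  constructor
  · rintro ⟨hxy, hx, hy⟩
    exact (sup_adj_left h₁ h₂ hd hx).1 hxy
  · exact fun h => ⟨Or.inl h, h₁.mem _ _ h, h₁.mem _ _ h.symm⟩

theorem within_glue_left_eq (h₁ : IsMarkedForest L G₁ J₁) (h₂ : IsMarkedForest K G₂ J₂)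
    (hd : Disjoint L K) (hr : r ∈ L) (hc : c ∈ K) :
    (G₁ ⊔ G₂ ⊔ edge r c).within L = G₁ := by
  ext x y
  constructor
  · rintro ⟨hxy | hxy, hx, hy⟩
    · exact (sup_adj_left h₁ h₂ hd hx).1 hxy
    · rw [edge_adj_left h₁ h₂ hd hr hc hx] at hxy
      exact absurd (hxy.2 ▸ hc) (Finset.disjoint_left.1 hd hy)
  · exact fun h => ⟨Or.inl (Or.inl h), h₁.mem _ _ h, h₁.mem _ _ h.symm⟩

theorem subset_of_sup_eq (h₁ : IsMarkedForest L G₁ J₁) (h₂ : IsMarkedForest K G₂ J₂)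
    (hd : Disjoint L K) (hv : v ∈ K) (hv' : v ∈ K') (c₂' : ∀ x ∈ K', G₂'.Reachable c' x)
    (heq : G₁ ⊔ G₂ = G₁' ⊔ G₂') : K' ⊆ K := by
  intro x hx
  refine (Reachable.mem_and_reachable (G := G₂') (H := G₂') (K := K) (fun u w hu huw => ⟨?_, huw⟩)
    hv ((c₂' v hv').symm.trans (c₂' x hx))).1
  have : (G₁ ⊔ G₂).Adj u w := heq ▸ Or.inr huw
  exact h₂.mem _ _ ((sup_adj_right h₁ h₂ hd hu).1 this).symm

theorem subset_of_glue_eq (h₁ : IsMarkedForest L G₁ J₁) (h₂ : IsMarkedForest K G₂ J₂)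
    (hd : Disjoint L K) (hr : r ∈ L) (hc : c ∈ K) (hv : v ∈ K) (hv' : v ∈ K')
    (h₂' : IsMarkedForest K' G₂' J₂') (hr' : r ∉ K') (c₂' : ∀ x ∈ K', G₂'.Reachable c' x)
    (heq : G₁ ⊔ G₂ ⊔ edge r c = G₁' ⊔ G₂' ⊔ edge r c') : K' ⊆ K := by
  intro x hx
  refine (Reachable.mem_and_reachable (G := G₂') (H := G₂') (K := K) (fun u w hu huw => ⟨?_, huw⟩)
    hv ((c₂' v hv').symm.trans (c₂' x hx))).1
  have : (G₁ ⊔ G₂ ⊔ edge r c).Adj u w := heq ▸ Or.inl (Or.inr huw)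
  rcases this with h | h
  · exact h₂.mem _ _ ((sup_adj_right h₁ h₂ hd hu).1 h).symm
  · rw [edge_adj_right h₁ h₂ hd hr hc hu] at h
    exact absurd (h.2 ▸ h₂'.mem _ _ huw.symm) hr'

end injectivity

end IsMarkedForest

open SimpleGraph IsMarkedForest

theorem ncard_forestConf_sep {Y : Prop → Prop → Prop} (hY : ∀ j d, Y j d → j ∨ d)
    {S : Finset ℕ} {v : ℕ} (hv : v ∈ S) :
    {p ∈ forestConf S | Y (v ∈ p.2) (IsDominated p.1 p.2 v)}.ncard =
      ∑ K ∈ S.powerset with v ∈ K, (forestConf (S \ K)).ncard * (treeConf Y K v).ncard := by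
  refine Set.ncard_eq_sum_mul _ (fun K => forestConf (S \ K)) (fun K => treeConf Y K v) _
    (fun _ p q => (p.1 ⊔ q.1, p.2 ∪ q.2)) (fun _ => finite_forestConf _)
    (fun _ => finite_treeConf _ _ _) ?_ ?_ ?_
  · rintro K hK ⟨G₁, J₁⟩ h₁ ⟨G₂, J₂⟩ h₂
    simp only [Finset.mem_filter, Finset.mem_powerset] at hK
    have := (sup_mem_forestConf_iff hY h₁.1 h₂.1 Finset.sdiff_disjoint hK.2 h₂.2.1).2 ⟨h₁, h₂⟩
    rwa [Finset.sdiff_union_of_subset hK.1] at this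
  · rintro K hK ⟨G₁, J₁⟩ h₁ ⟨G₂, J₂⟩ h₂ K' hK' ⟨G₁', J₁'⟩ h₁' ⟨G₂', J₂'⟩ h₂' heq
    simp only [Finset.mem_filter, Finset.mem_powerset, Prod.mk.injEq] at hK hK' heq
    have hKK : K = K' := Finset.Subset.antisymm
      (subset_of_sup_eq h₁'.1 h₂'.1 Finset.sdiff_disjoint hK'.2 hK.2 h₂.2.1 heq.1.symm)
      (subset_of_sup_eq h₁.1 h₂.1 Finset.sdiff_disjoint hK.2 hK'.2 h₂'.2.1 heq.1)
    subst hKK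
    have hd : Disjoint (S \ K) K := Finset.sdiff_disjoint
    refine ⟨rfl, Prod.ext ?_ ?_, Prod.ext ?_ ?_⟩
    · exact (within_left_eq h₁.1 h₂.1 hd).symm.trans (heq.1 ▸ within_left_eq h₁'.1 h₂'.1 hd)
    · exact (inter_left_eq h₁.1 h₂.1 hd).symm.trans (heq.2 ▸ inter_left_eq h₁'.1 h₂'.1 hd)
    · rw [sup_comm, sup_comm G₁'] at heq
      exact (within_left_eq h₂.1 h₁.1 hd.symm).symm.trans
        (heq.1 ▸ within_left_eq h₂'.1 h₁'.1 hd.symm)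
    · rw [Set.union_comm, Set.union_comm J₁'] at heq
      exact (inter_left_eq h₂.1 h₁.1 hd.symm).symm.trans
        (heq.2 ▸ inter_left_eq h₂'.1 h₁'.1 hd.symm)
  · classical
    rintro ⟨G, J⟩ hG
    have hF : IsMarkedForest S G J := hG.1.1
    let K := S.filter fun x => G.Reachable v x
    have hKS : K ⊆ S := Finset.filter_subset _ _
    have hvK : v ∈ K := Finset.mem_filter.2 ⟨hv, .rfl⟩
    have step : ∀ x y, x ∈ K → G.Adj x y → y ∈ K := fun x y hx hxy =>
      Finset.mem_filter.2 ⟨hF.mem _ _ hxy.symm, (Finset.mem_filter.1 hx).2.trans hxy.reachable⟩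
    have hGeq : G.within ↑(S \ K) ⊔ G.within ↑K = G := by
      ext x y
      constructor
      · rintro (h | h) <;> exact h.1
      · intro h
        have hx := hF.mem _ _ h
        have hy := hF.mem _ _ h.symm
        by_cases hxK : x ∈ K
        · exact Or.inr ⟨h, hxK, step _ _ hxK h⟩
        · refine Or.inl ⟨h, ?_, ?_⟩
          · exact_mod_cast Finset.mem_sdiff.2 ⟨hx, hxK⟩
          · exact_mod_cast Finset.mem_sdiff.2 ⟨hy, fun hyK => hxK (step _ _ hyK h.symm)⟩
    have hJeq : J ∩ ↑(S \ K) ∪ J ∩ ↑K = J := by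
      rw [← Set.inter_union_distrib_left, ← Finset.coe_union, Finset.sdiff_union_of_subset hKS]
      exact Set.inter_eq_left.2 hF.sub
    have conn₂ : ∀ x ∈ K, (G.within ↑K).Reachable v x := fun x hx =>
      (Reachable.mem_and_reachable (K := K) (H := G.within ↑K)
        (fun u w hu huw => ⟨step _ _ hu huw, huw, hu, step _ _ hu huw⟩) hvK
        (Finset.mem_filter.1 hx).2).2
    have := (sup_mem_forestConf_iff (Y := Y) hY (hF.within (S \ K)) (hF.within K)
      Finset.sdiff_disjoint hvK conn₂).1
      (by rwa [hGeq, hJeq, Finset.sdiff_union_of_subset hKS])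
    exact ⟨K, Finset.mem_filter.2 ⟨Finset.mem_powerset.2 hKS, hvK⟩, _, this.1, _, this.2,
      Prod.ext hGeq hJeq⟩

theorem ncard_treeConf {X Y : Prop → Prop → Prop}
    (hXY : ∀ j₁ d₁ j₂ d₂ : Prop, (X j₁ (d₁ ∨ j₂) ∧ ¬ (j₁ ∧ j₂) ∧ (j₂ ∨ j₁ ∨ d₂)) ↔
      X j₁ d₁ ∧ Y j₂ d₂)
    {S : Finset ℕ} {r v : ℕ} (hr : r ∈ S) (hv : v ∈ S) (hrv : r ≠ v) :
    (treeConf X S r).ncard =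
      ∑ K ∈ (S.erase r).powerset with v ∈ K, ∑ c ∈ K,
        (treeConf X (S \ K) r).ncard * (treeConf Y K c).ncard := by
  rw [← Finset.sum_sigma {K ∈ (S.erase r).powerset | v ∈ K} (fun K => K)
    (fun i => (treeConf X (S \ i.1) r).ncard * (treeConf Y i.1 i.2).ncard)]
  refine Set.ncard_eq_sum_mul _ (fun i : (_ : Finset ℕ) × ℕ => treeConf X (S \ i.1) r)
    (fun i => treeConf Y i.1 i.2) _
    (fun i p q => (p.1 ⊔ q.1 ⊔ edge r i.2, p.2 ∪ q.2)) (fun _ => finite_treeConf _ _ _)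
    (fun _ => finite_treeConf _ _ _) ?_ ?_ ?_
  · rintro ⟨K, c⟩ hK ⟨G₁, J₁⟩ h₁ ⟨G₂, J₂⟩ h₂
    simp only [Finset.mem_sigma, Finset.mem_filter, Finset.mem_powerset] at hK
    obtain ⟨⟨hKS, hvK⟩, hcK⟩ := hK
    have hrK : r ∈ S \ K := Finset.mem_sdiff.2 ⟨hr, fun h => Finset.notMem_erase _ _ (hKS h)⟩
    have := (glue_mem_treeConf_iff hXY h₁.1 h₂.1 Finset.sdiff_disjoint hrK hcK h₁.2.1 h₂.2.1).2
      ⟨h₁, h₂⟩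
    rwa [Finset.sdiff_union_of_subset (hKS.trans (Finset.erase_subset _ _))] at this
  · rintro ⟨K, c⟩ hK ⟨G₁, J₁⟩ h₁ ⟨G₂, J₂⟩ h₂ ⟨K', c'⟩ hK' ⟨G₁', J₁'⟩ h₁' ⟨G₂', J₂'⟩ h₂' heq
    simp only [Finset.mem_sigma, Finset.mem_filter, Finset.mem_powerset, Prod.mk.injEq]
      at hK hK' heq h₁ h₂ h₁' h₂'
    obtain ⟨⟨hKS, hvK⟩, hcK⟩ := hK
    obtain ⟨⟨hKS', hvK'⟩, hcK'⟩ := hK'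
    have hrK : r ∈ S \ K := Finset.mem_sdiff.2 ⟨hr, fun h => Finset.notMem_erase _ _ (hKS h)⟩
    have hrK' : r ∈ S \ K' := Finset.mem_sdiff.2 ⟨hr, fun h => Finset.notMem_erase _ _ (hKS' h)⟩
    have hKK : K = K' := Finset.Subset.antisymm
      (subset_of_glue_eq h₁'.1 h₂'.1 Finset.sdiff_disjoint hrK' hcK' hvK' hvK h₂.1
        (Finset.mem_sdiff.1 hrK).2 h₂.2.1 heq.1.symm)
      (subset_of_glue_eq h₁.1 h₂.1 Finset.sdiff_disjoint hrK hcK hvK hvK' h₂'.1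
        (Finset.mem_sdiff.1 hrK').2 h₂'.2.1 heq.1)
    subst hKK
    have hd : Disjoint (S \ K) K := Finset.sdiff_disjoint
    have hcc : c = c' := by
      have : (G₁' ⊔ G₂' ⊔ edge r c').Adj r c :=
        heq.1 ▸ Or.inr ((edge_adj_left h₁.1 h₂.1 hd hrK hcK hrK).2 ⟨rfl, rfl⟩)
      rcases this with h | h
      · have := h₁'.1.mem _ _ ((sup_adj_left h₁'.1 h₂'.1 hd hrK).1 h).symm
        exact absurd hcK (Finset.mem_sdiff.1 this).2
      · exact ((edge_adj_left h₁'.1 h₂'.1 hd hrK hcK' hrK).1 h).2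
    subst hcc
    refine ⟨rfl, Prod.ext ?_ ?_, Prod.ext ?_ ?_⟩
    · exact (within_glue_left_eq h₁.1 h₂.1 hd hrK hcK).symm.trans
        (heq.1 ▸ within_glue_left_eq h₁'.1 h₂'.1 hd hrK hcK)
    · exact (inter_left_eq h₁.1 h₂.1 hd).symm.trans (heq.2 ▸ inter_left_eq h₁'.1 h₂'.1 hd)
    · rw [sup_comm G₁, sup_comm G₁', edge_comm] at heq
      exact (within_glue_left_eq h₂.1 h₁.1 hd.symm hcK hrK).symm.trans
        (heq.1 ▸ within_glue_left_eq h₂'.1 h₁'.1 hd.symm hcK hrK)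
    · rw [Set.union_comm, Set.union_comm J₁'] at heq
      exact (inter_left_eq h₂.1 h₁.1 hd.symm).symm.trans
        (heq.2 ▸ inter_left_eq h₂'.1 h₁'.1 hd.symm)
  · classical
    rintro ⟨G, J⟩ hG
    have hF : IsMarkedForest S G J := hG.1
    obtain ⟨c, hrc, hcv⟩ := (hG.2.1 v hv).exists_adj_deleteEdges hrv
    set G' := G.deleteEdges {s(r, c)} with hG'
    have hbridge : ¬ G'.Reachable r c :=
      isBridge_iff.1 (isAcyclic_iff_forall_adj_isBridge.1 hF.acyclic hrc)
    let K := S.filter fun x => G'.Reachable c x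
    have hKS : K ⊆ S := Finset.filter_subset _ _
    have hvK : v ∈ K := Finset.mem_filter.2 ⟨hv, hcv⟩
    have hcK : c ∈ K := Finset.mem_filter.2 ⟨hF.mem _ _ hrc.symm, .rfl⟩
    have hrK : r ∉ K := fun h => hbridge (Finset.mem_filter.1 h).2.symm
    have hrL : r ∈ S \ K := Finset.mem_sdiff.2 ⟨hr, hrK⟩
    have hKS' : K ⊆ S.erase r := fun x hx =>
      Finset.mem_erase.2 ⟨fun h => hrK (h ▸ hx), hKS hx⟩
    have hle : G' ≤ G := deleteEdges_le _
    have step : ∀ x y, x ∈ K → G'.Adj x y → y ∈ K := fun x y hx hxy =>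
      Finset.mem_filter.2 ⟨hF.mem _ _ (hle hxy).symm,
        (Finset.mem_filter.1 hx).2.trans hxy.reachable⟩
    have stepL : ∀ x y, x ∈ S \ K → G'.Adj x y → y ∈ S \ K := fun x y hx hxy =>
      Finset.mem_sdiff.2 ⟨hF.mem _ _ (hle hxy).symm,
        fun hy => (Finset.mem_sdiff.1 hx).2 (step _ _ hy hxy.symm)⟩
    have hGeq : G.within ↑(S \ K) ⊔ G.within ↑K ⊔ edge r c = G := by
      ext x y
      constructor
      · rintro ((h | h) | h)
        · exact h.1
        · exact h.1
        · rw [edge_adj] at h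
          rcases h.1 with ⟨rfl, rfl⟩ | ⟨rfl, rfl⟩
          exacts [hrc, hrc.symm]
      · intro h
        by_cases he : s(x, y) = s(r, c)
        · refine Or.inr ((edge_adj ..).2 ⟨Sym2.eq_iff.1 he, h.ne⟩)
        · have h' : G'.Adj x y := deleteEdges_adj.2 ⟨h, by simpa using he⟩
          refine Or.inl ?_
          by_cases hxK : x ∈ K
          · exact Or.inr ⟨h, hxK, step _ _ hxK h'⟩
          · have hx : x ∈ S \ K := Finset.mem_sdiff.2 ⟨hF.mem _ _ h, hxK⟩
            exact Or.inl ⟨h, hx, stepL _ _ hx h'⟩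
    have hJeq : J ∩ ↑(S \ K) ∪ J ∩ ↑K = J := by
      rw [← Set.inter_union_distrib_left, ← Finset.coe_union, Finset.sdiff_union_of_subset hKS]
      exact Set.inter_eq_left.2 hF.sub
    have conn₁ : ∀ x ∈ S \ K, (G.within ↑(S \ K)).Reachable r x := fun x hx => by
      have hx' := Finset.mem_sdiff.1 hx
      have : G'.Reachable r x := ((hG.2.1 x hx'.1).deleteEdges_or (c := c)).resolve_right
        fun h => hx'.2 (Finset.mem_filter.2 ⟨hx'.1, h⟩)
      exact (Reachable.mem_and_reachable (K := ↑(S \ K))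
        (H := G.within ↑(S \ K))
        (fun u w hu huw => ⟨stepL _ _ hu huw, hle huw, hu, stepL _ _ hu huw⟩) hrL this).2
    have conn₂ : ∀ x ∈ K, (G.within ↑K).Reachable c x := fun x hx =>
      (Reachable.mem_and_reachable (K := K) (H := G.within ↑K)
        (fun u w hu huw => ⟨step _ _ hu huw, hle huw, hu, step _ _ hu huw⟩) hcK
        (Finset.mem_filter.1 hx).2).2
    have := (glue_mem_treeConf_iff hXY (hF.within (S \ K)) (hF.within K)
      Finset.sdiff_disjoint hrL hcK conn₁ conn₂).1
      (by rwa [hGeq, hJeq, Finset.sdiff_union_of_subset hKS])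
    exact ⟨⟨K, c⟩, Finset.mem_sigma.2 ⟨Finset.mem_filter.2 ⟨Finset.mem_powerset.2 hKS', hvK⟩, hcK⟩,
      _, this.1, _, this.2, Prod.ext hGeq hJeq⟩

end

section

open SimpleGraph

/-- Pull back a graph with a set of marked vertices along a permutation. -/
def relabel (e : Equiv.Perm ℕ) (p : SimpleGraph ℕ × Set ℕ) : SimpleGraph ℕ × Set ℕ :=
  (p.1.comap e, e ⁻¹' p.2)

theorem relabel_injective (e : Equiv.Perm ℕ) : Function.Injective (relabel e) := by
  rintro ⟨G, J⟩ ⟨G', J'⟩ h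
  simp only [relabel, Prod.mk.injEq] at h
  refine Prod.ext ?_ (e.surjective.preimage_injective h.2)
  ext x y
  obtain ⟨x, rfl⟩ := e.surjective x
  obtain ⟨y, rfl⟩ := e.surjective y
  exact (congrArg (fun H => H.Adj x y) h.1).to_iff

theorem isDominated_relabel (e : Equiv.Perm ℕ) (p : SimpleGraph ℕ × Set ℕ) (x : ℕ) :
    IsDominated (relabel e p).1 (relabel e p).2 x ↔ IsDominated p.1 p.2 (e x) :=
  e.exists_congr_left.trans (by simp [IsDominated, relabel])

theorem IsMarkedForest.relabel {e : Equiv.Perm ℕ} {S S' : Finset ℕ} (hS : ∀ x, e x ∈ S' ↔ x ∈ S)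
    {p : SimpleGraph ℕ × Set ℕ} (h : IsMarkedForest S' p.1 p.2) :
    IsMarkedForest S (relabel e p).1 (relabel e p).2 where
  mem u _ huv := (hS u).1 (h.mem _ _ huv)
  sub u hu := (hS u).1 (h.sub _ hu)
  indep _ _ hu hv huv := h.indep _ _ hu hv huv
  acyclic := h.acyclic.comap (Hom.comap e p.1) e.injective

theorem relabel_mem_treeConf {X : Prop → Prop → Prop} {e : Equiv.Perm ℕ} {S S' : Finset ℕ}
    (hS : ∀ x, e x ∈ S' ↔ x ∈ S) {r : ℕ} {p : SimpleGraph ℕ × Set ℕ}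
    (h : p ∈ treeConf X S' (e r)) : relabel e p ∈ treeConf X S r := by
  refine ⟨h.1.relabel hS, fun x hx => ?_, fun x hx hxr => ?_, ?_⟩
  · exact (Iso.reachable_iff (φ := Iso.comap e p.1)).1 (h.2.1 _ ((hS x).2 hx))
  · rw [isDominated_relabel]
    exact h.2.2.1 _ ((hS x).2 hx) (e.injective.ne hxr)
  · rw [isDominated_relabel]
    exact h.2.2.2

theorem relabel_mem_forestConf {e : Equiv.Perm ℕ} {S S' : Finset ℕ}
    (hS : ∀ x, e x ∈ S' ↔ x ∈ S) {p : SimpleGraph ℕ × Set ℕ}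
    (h : p ∈ forestConf S') : relabel e p ∈ forestConf S := by
  refine ⟨h.1.relabel hS, fun x hx => ?_⟩
  rw [isDominated_relabel]
  exact h.2 _ ((hS x).2 hx)

theorem Finset.exists_embedding_fin (S : Finset ℕ) {k : ℕ} (h : S.card = k + 1) {r : ℕ}
    (hr : r ∈ S) : ∃ f : Fin (k + 1) ↪ ℕ, f 0 = r ∧ ∀ x, x ∈ S ↔ ∃ i, f i = x := by
  let g := (S.equivFinOfCardEq h).symm
  refine ⟨(g.trans (Equiv.swap (g 0) ⟨r, hr⟩)).toEmbedding.trans (Function.Embedding.subtype _),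
    by simp, fun x => ⟨fun hx => ?_, ?_⟩⟩
  · exact ⟨(g.trans (Equiv.swap (g 0) ⟨r, hr⟩)).symm ⟨x, hx⟩, by simp⟩
  · rintro ⟨i, rfl⟩
    exact Subtype.property _

theorem exists_perm_finset {S S' : Finset ℕ} (h : S.card = S'.card) {r r' : ℕ} (hr : r ∈ S)
    (hr' : r' ∈ S') : ∃ e : Equiv.Perm ℕ, e r = r' ∧ ∀ x, e x ∈ S' ↔ x ∈ S := by
  obtain ⟨k, hk⟩ := Nat.exists_eq_succ_of_ne_zero (Finset.card_ne_zero_of_mem hr)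
  obtain ⟨f, hf, hfS⟩ := S.exists_embedding_fin hk hr
  obtain ⟨f', hf', hfS'⟩ := S'.exists_embedding_fin (h ▸ hk) hr'
  obtain ⟨e, he⟩ := (Equiv.Perm.isMultiplyPretransitive ℕ (k + 1)).exists_smul_eq f f'
  have he' : ∀ i, e (f i) = f' i := fun i => DFunLike.congr_fun he i
  refine ⟨e, by rw [← hf, ← hf', he'], fun x => ?_⟩
  rw [hfS, hfS']
  exact exists_congr fun i => by rw [← he', e.injective.eq_iff]

theorem ncard_treeConf_le {X : Prop → Prop → Prop} {S S' : Finset ℕ} (h : S.card = S'.card)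
    {r r' : ℕ} (hr : r ∈ S) (hr' : r' ∈ S') :
    (treeConf X S' r').ncard ≤ (treeConf X S r).ncard := by
  obtain ⟨e, rfl, he⟩ := exists_perm_finset h hr hr'
  exact Set.ncard_le_ncard_of_injOn _ (fun _ => relabel_mem_treeConf he)
    (relabel_injective e).injOn (finite_treeConf _ _ _)

theorem ncard_forestConf_le {S S' : Finset ℕ} (h : S.card = S'.card) :
    (forestConf S').ncard ≤ (forestConf S).ncard := by
  rcases S.eq_empty_or_nonempty with rfl | ⟨r, hr⟩
  · rw [Finset.card_eq_zero.1 (h.symm.trans Finset.card_empty)]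
  have : S'.Nonempty := Finset.card_ne_zero.1 (h ▸ Finset.card_ne_zero_of_mem hr)
  obtain ⟨r', hr'⟩ := this
  obtain ⟨e, rfl, he⟩ := exists_perm_finset h hr hr'
  exact Set.ncard_le_ncard_of_injOn _ (fun _ => relabel_mem_forestConf he)
    (relabel_injective e).injOn (finite_forestConf _)

/-- The number of rooted tree configurations on `n` vertices whose root satisfies `X`. -/
noncomputable def treeCount (X : Prop → Prop → Prop) (n : ℕ) : ℕ :=
  (treeConf X (Finset.range n) 0).ncard

/-- The number of pairs of a forest on `n` vertices and a maximal independent set of it. -/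
noncomputable def forestCount (n : ℕ) : ℕ := (forestConf (Finset.range n)).ncard

theorem ncard_treeConf_eq {X : Prop → Prop → Prop} {S : Finset ℕ} {r : ℕ} (hr : r ∈ S) :
    (treeConf X S r).ncard = treeCount X S.card := by
  have h0 : 0 ∈ Finset.range S.card :=
    Finset.mem_range.2 (Nat.pos_of_ne_zero (Finset.card_ne_zero_of_mem hr))
  exact le_antisymm (ncard_treeConf_le (by simp) h0 hr) (ncard_treeConf_le (by simp) hr h0)

theorem ncard_forestConf_eq (S : Finset ℕ) : (forestConf S).ncard = forestCount S.card :=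
  le_antisymm (ncard_forestConf_le (by simp)) (ncard_forestConf_le (by simp))

theorem Finset.sum_powerset_filter_mem {E : Finset ℕ} {m v : ℕ} (hv : v ∈ E) (hE : E.card = m + 1)
    (f : ℕ → ℕ) : ∑ K ∈ E.powerset with v ∈ K, f K.card =
      ∑ k ∈ range (m + 1), m.choose k * f (k + 1) := by
  have : ∑ K ∈ E.powerset with v ∈ K, f K.card = ∑ K ∈ (E.erase v).powerset, f (K.card + 1) := by
    refine sum_nbij' (fun K => K.erase v) (fun K => insert v K) ?_ ?_ ?_ ?_ ?_
    · intro K hK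
      simp only [mem_filter, mem_powerset] at hK ⊢
      exact erase_subset_erase _ hK.1
    · intro K hK
      simp only [mem_filter, mem_powerset] at hK ⊢
      exact ⟨insert_subset hv (hK.trans (erase_subset _ _)), mem_insert_self _ _⟩
    · intro K hK
      exact insert_erase (mem_filter.1 hK).2
    · intro K hK
      exact erase_insert fun h => notMem_erase v E (mem_powerset.1 hK h)
    · intro K hK
      rw [card_erase_add_one (mem_filter.1 hK).2]
  rw [this, sum_powerset_apply_card (fun k => f (k + 1)), card_erase_of_mem hv, hE]
  simp

theorem treeCount_add_two {X Y : Prop → Prop → Prop}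
    (hXY : ∀ j₁ d₁ j₂ d₂ : Prop, (X j₁ (d₁ ∨ j₂) ∧ ¬ (j₁ ∧ j₂) ∧ (j₂ ∨ j₁ ∨ d₂)) ↔
      X j₁ d₁ ∧ Y j₂ d₂) (n : ℕ) :
    treeCount X (n + 2) = ∑ k ∈ Finset.range (n + 1),
      n.choose k * ((k + 1) * (treeCount X (n + 1 - k) * treeCount Y (k + 1))) := by
  have hv : 1 ∈ (Finset.range (n + 2)).erase 0 := by simp
  have hr : 0 ∈ Finset.range (n + 2) := by simp
  rw [treeCount, ncard_treeConf hXY hr (Finset.mem_of_mem_erase hv) zero_ne_one]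
  have := Finset.sum_powerset_filter_mem (m := n) hv (by simp)
    fun k => k * (treeCount X (n + 2 - k) * treeCount Y k)
  simp only [show ∀ k, n + 2 - (k + 1) = n + 1 - k from
    fun k => Nat.add_sub_add_right _ 1 _] at this
  rw [← this]
  refine Finset.sum_congr rfl fun K hK => ?_
  simp only [Finset.mem_filter, Finset.mem_powerset] at hK
  have hK' := hK.1.trans (Finset.erase_subset _ _)
  rw [← smul_eq_mul K.card, ← Finset.sum_const]
  refine Finset.sum_congr rfl fun c hc => ?_
  rw [ncard_treeConf_eq hc, ncard_treeConf_eq, Finset.card_sdiff_of_subset hK', Finset.card_range]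
  exact Finset.mem_sdiff.2 ⟨hr, fun h => Finset.notMem_erase _ _ (hK.1 h)⟩

theorem ncard_forestConf_sep_eq {Y : Prop → Prop → Prop} (hY : ∀ j d, Y j d → j ∨ d) {n v : ℕ}
    (hv : v ∈ Finset.range (n + 1)) :
    {p ∈ forestConf (Finset.range (n + 1)) | Y (v ∈ p.2) (IsDominated p.1 p.2 v)}.ncard =
      ∑ k ∈ Finset.range (n + 1), n.choose k * (forestCount (n - k) * treeCount Y (k + 1)) := by
  rw [ncard_forestConf_sep hY hv]
  have := Finset.sum_powerset_filter_mem (m := n) hv (by simp)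
    fun k => forestCount (n + 1 - k) * treeCount Y k
  simp only [Nat.add_sub_add_right n 1] at this
  rw [← this]
  refine Finset.sum_congr rfl fun K hK => ?_
  simp only [Finset.mem_filter, Finset.mem_powerset] at hK
  rw [ncard_treeConf_eq hK.2, ncard_forestConf_eq, Finset.card_sdiff_of_subset hK.1,
    Finset.card_range]

theorem forestCount_add_one (n : ℕ) : forestCount (n + 1) =
    ∑ k ∈ Finset.range (n + 1),
      n.choose k * (forestCount (n - k) * treeCount (fun j d => j ∨ d) (k + 1)) := by
  rw [← ncard_forestConf_sep_eq (v := 0) (fun _ _ => id) (by simp), forestCount]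
  congr 1
  ext p
  exact ⟨fun h => ⟨h, h.2 _ (by simp)⟩, fun h => h.1⟩

theorem treeCount_add {X Y Z : Prop → Prop → Prop} (h : ∀ j d, Z j d ↔ X j d ∨ Y j d)
    (hd : ∀ j d, X j d → ¬ Y j d) (n : ℕ) : treeCount Z n = treeCount X n + treeCount Y n := by
  rw [treeCount, treeCount, treeCount, ← Set.ncard_union_eq _ (finite_treeConf _ _ _)
    (finite_treeConf _ _ _)]
  · congr 1
    ext p
    simp only [treeConf, h, Set.mem_ofPred_eq, Set.mem_union]
    tauto
  · exact Set.disjoint_left.2 fun p h₁ h₂ => hd _ _ h₁.2.2.2 h₂.2.2.2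

theorem IsMarkedForest.eq_bot {G : SimpleGraph ℕ} {J : Set ℕ} {S : Finset ℕ}
    (hS : (S : Set ℕ).Subsingleton) (h : IsMarkedForest S G J) : G = ⊥ := by
  ext x y
  simp only [bot_adj, iff_false]
  exact fun hxy => hxy.ne (hS (h.mem _ _ hxy) (h.mem _ _ hxy.symm))

theorem isMarkedForest_bot {J : Set ℕ} {S : Finset ℕ} (h : ∀ x ∈ J, x ∈ S) :
    IsMarkedForest S ⊥ J where
  mem _ _ h := h.elim
  sub := h
  indep _ _ _ _ h := h
  acyclic := isAcyclic_bot

theorem treeCount_one_in : treeCount (fun j _ => j) 1 = 1 := by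
  rw [treeCount, Set.ncard_eq_one]
  refine ⟨(⊥, {0}), Set.eq_singleton_iff_unique_mem.2 ⟨⟨isMarkedForest_bot (by simp), ?_, ?_, ?_⟩,
    ?_⟩⟩
  · simp
  · simp
  · simp
  · rintro ⟨G, J⟩ ⟨h, -, -, h0⟩
    refine Prod.ext (h.eq_bot (by simp)) (Set.eq_singleton_iff_unique_mem.2 ⟨h0, fun x hx => ?_⟩)
    simpa using h.sub x hx

theorem treeCount_one_out {X : Prop → Prop → Prop} (h₁ : X False False)
    (h₂ : ∀ j d, X j d → ¬ j) : treeCount X 1 = 1 := by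
  rw [treeCount, Set.ncard_eq_one]
  refine ⟨(⊥, ∅), Set.eq_singleton_iff_unique_mem.2 ⟨⟨isMarkedForest_bot (by simp), ?_, ?_, ?_⟩,
    ?_⟩⟩
  · simp
  · simp
  · simpa [IsDominated] using h₁
  · rintro ⟨G, J⟩ ⟨h, -, -, h0⟩
    refine Prod.ext (h.eq_bot (by simp)) (Set.eq_empty_iff_forall_notMem.2 fun x hx => h₂ _ _ h0 ?_)
    have : x = 0 := by simpa using h.sub x hx
    exact this ▸ hx

theorem forestCount_zero : forestCount 0 = 1 := by
  rw [forestCount, Set.ncard_eq_one]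
  refine ⟨(⊥, ∅), Set.eq_singleton_iff_unique_mem.2 ⟨⟨isMarkedForest_bot (by simp), by simp⟩, ?_⟩⟩
  rintro ⟨G, J⟩ ⟨h, -⟩
  exact Prod.ext (h.eq_bot (by simp)) (Set.eq_empty_iff_forall_notMem.2 fun x hx => by
    simpa using h.sub x hx)

end

section

open SimpleGraph

theorem isMaximalIndepSet_iff_dominating {V : Type*} (G : SimpleGraph V) (J : Set V) :
    IsMaximalIndepSet G J ↔ (∀ u v, u ∈ J → v ∈ J → ¬ G.Adj u v) ∧
      ∀ x, x ∈ J ∨ ∃ y ∈ J, G.Adj x y := by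
  refine and_congr_right fun hJ => ⟨fun h x => ?_, fun h J' hJ' hss => ?_⟩
  · by_contra! hx
    refine h (insert x J) ?_ (Set.ssubset_insert hx.1)
    rintro u v (rfl | hu) (rfl | hv) huv
    · exact huv.ne rfl
    · exact hx.2 v hv huv
    · exact hx.2 u hu huv.symm
    · exact hJ hu hv huv
  · obtain ⟨x, hx, hxJ⟩ := Set.exists_of_ssubset hss
    obtain ⟨y, hy, hxy⟩ := (h x).resolve_left hxJ
    exact hJ' hx (hss.1 hy) hxy

theorem SimpleGraph.IsAcyclic.map {V W : Type*} {G : SimpleGraph V} (h : G.IsAcyclic) (f : V ↪ W) :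
    (G.map f).IsAcyclic := by
  rw [isAcyclic_iff_forall_adj_isBridge] at *
  rintro _ _ ⟨-, u, v, huv, rfl, rfl⟩
  rw [isBridge_iff]
  intro hr
  have hG := isBridge_iff.1 (h huv)
  let K : Set W := {y | ∃ w, f w = y ∧ (G.deleteEdges {s(u, v)}).Reachable u w}
  have step : ∀ a b, a ∈ K → ((G.map f).deleteEdges {s(f u, f v)}).Adj a b → b ∈ K := by
    rintro _ b ⟨w, rfl, hw⟩ hab
    obtain ⟨⟨-, c, d, hcd, hc, rfl⟩, hne⟩ := deleteEdges_adj.1 hab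
    obtain rfl := f.injective hc
    refine ⟨d, rfl, hw.trans (Adj.reachable (deleteEdges_adj.2 ⟨hcd, fun he => hne ?_⟩))⟩
    have he' : s(c, d) = s(u, v) := he
    change Sym2.map f s(c, d) = Sym2.map f s(u, v)
    rw [he']
  obtain ⟨w, hw, hw'⟩ := (Reachable.mem_and_reachable (K := K)
    (fun a b ha hab => ⟨step a b ha hab, hab⟩) ⟨u, rfl, .rfl⟩ hr).1
  exact hG (f.injective hw ▸ hw')

namespace MISpace

variable {n : ℕ}

/-- The configuration on `ℕ` given by a pair in `MISpace n`. -/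
def toConf (p : MISpace n) : SimpleGraph ℕ × Set ℕ :=
  (p.1.1.map Fin.valEmbedding, Fin.val '' p.1.2)

theorem toConf_injective : Function.Injective (toConf (n := n)) := by
  rintro ⟨⟨G, J⟩, h⟩ ⟨⟨G', J'⟩, h'⟩ heq
  simp only [toConf, Prod.mk.injEq] at heq
  exact Subtype.ext (Prod.ext (map_injective _ heq.1) (Fin.val_injective.image_injective heq.2))

theorem val_mem_toConf (p : MISpace n) (v : Fin n) : v.1 ∈ p.toConf.2 ↔ v ∈ p.1.2 :=
  Fin.val_injective.mem_set_image

theorem range_toConf : Set.range (toConf (n := n)) = forestConf (Finset.range n) := by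
  ext ⟨G, J⟩
  constructor
  · rintro ⟨⟨⟨F, I⟩, hF, hI⟩, heq⟩
    rw [isMaximalIndepSet_iff_dominating] at hI
    simp only [toConf, Prod.mk.injEq] at heq
    obtain ⟨rfl, rfl⟩ := heq
    refine ⟨⟨?_, ?_, ?_, ?_⟩, ?_⟩
    · rintro _ _ ⟨-, u, v, -, rfl, rfl⟩
      simp
    · rintro _ ⟨u, -, rfl⟩
      simp
    · rintro _ _ ⟨u, hu, rfl⟩ ⟨v, hv, rfl⟩ h
      exact hI.1 u v hu hv ((map_adj_apply (f := Fin.valEmbedding)).1 h)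
    · exact hF.map Fin.valEmbedding
    · intro x hx
      have hx' : x < n := Finset.mem_range.1 hx
      refine (hI.2 ⟨x, hx'⟩).imp (fun h => ⟨_, h, rfl⟩) ?_
      rintro ⟨y, hy, hxy⟩
      exact ⟨y, ⟨y, hy, rfl⟩, (map_adj_apply (f := Fin.valEmbedding)).2 hxy⟩
  · rintro ⟨h, hdom⟩
    have hlt : ∀ x ∈ Finset.range n, ∃ i : Fin n, i.1 = x := fun x hx =>
      ⟨⟨x, Finset.mem_range.1 hx⟩, rfl⟩
    refine ⟨⟨(G.comap Fin.val, Fin.val ⁻¹' J), ?_, ?_⟩, Prod.ext ?_ ?_⟩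
    · exact h.acyclic.comap (Hom.comap Fin.val G) Fin.val_injective
    · refine (isMaximalIndepSet_iff_dominating _ _).2
        ⟨fun u v hu hv => h.indep _ _ hu hv, fun x => ?_⟩
      refine (hdom x (by simp)).imp id ?_
      rintro ⟨y, hy, hxy⟩
      obtain ⟨i, rfl⟩ := hlt y (h.sub y hy)
      exact ⟨i, hy, hxy⟩
    · ext x y
      constructor
      · rintro ⟨-, u, v, huv, rfl, rfl⟩
        exact huv
      · intro hxy
        obtain ⟨i, rfl⟩ := hlt x (h.mem _ _ hxy)
        obtain ⟨j, rfl⟩ := hlt y (h.mem _ _ hxy.symm)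
        exact (map_adj_apply (f := Fin.valEmbedding)).2 hxy
    · refine Set.image_preimage_eq_iff.2 fun x hx => ?_
      exact hlt x (h.sub x hx)

instance : Finite (MISpace n) :=
  Set.finite_range_iff toConf_injective |>.1 (range_toConf ▸ finite_forestConf _)

end MISpace

theorem iN_eq (n : ℕ) : iN n = forestCount n := by
  rw [iN, forestCount, ← MISpace.range_toConf, ← Set.image_univ,
    Set.ncard_image_of_injective _ MISpace.toConf_injective, Set.ncard_univ]

/-- The number of pairs counted by `forestCount (n + 1)` with a given vertex selected. -/
noncomputable def selectedCount (n : ℕ) : ℕ :=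
  ∑ k ∈ Finset.range (n + 1), n.choose k *
    (forestCount (n - k) * treeCount (fun j _ => j) (k + 1))

theorem ncard_setOf_mem (n : ℕ) (v : Fin (n + 1)) :
    {p : MISpace (n + 1) | v ∈ p.1.2}.ncard = selectedCount n := by
  rw [selectedCount, ← ncard_forestConf_sep_eq (v := v.1) (fun _ _ => Or.inl) (by simp [v.is_le]),
    ← Set.ncard_image_of_injective _ MISpace.toConf_injective]
  congr 1
  ext q
  simp only [← MISpace.range_toConf]
  constructor
  · rintro ⟨p, hp, rfl⟩
    exact ⟨⟨p, rfl⟩, (p.val_mem_toConf v).2 hp⟩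
  · rintro ⟨⟨p, rfl⟩, hp⟩
    exact ⟨p, (p.val_mem_toConf v).1 hp, rfl⟩

theorem En_eq (n : ℕ) : En (n + 1) = (n + 1) * selectedCount n / forestCount (n + 1) := by
  classical
  have := Fintype.ofFinite (MISpace (n + 1))
  rw [En, iN_eq, finsum_eq_sum_of_fintype, ← Nat.cast_sum]
  congr 1
  have h1 : ∀ p : MISpace (n + 1), p.val.2.ncard = ∑ v, if v ∈ p.val.2 then 1 else 0 := fun p => by
    rw [Finset.sum_boole, Set.ncard_eq_toFinset_card']
    simp
  have h2 : ∀ v, (∑ p : MISpace (n + 1), if v ∈ p.val.2 then 1 else 0) = selectedCount n :=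
    fun v => by
      rw [Finset.sum_boole, ← ncard_setOf_mem n v, Set.ncard_eq_toFinset_card']
      simp
  simp only [h1]
  rw [Finset.sum_comm]
  simp [h2]

end

section

namespace PowerSeries

variable {R : Type*} [Field R]

theorem eq_of_derivative_eq_mul [CharZero R] {P Q S : R⟦X⟧}
    (hP : d⁄dX R P = P * Q) (hS : d⁄dX R S = S * Q)
    (h0 : constantCoeff P = constantCoeff S) (hS0 : constantCoeff S ≠ 0) : P = S := by
  have hu : S * S⁻¹ = 1 := PowerSeries.mul_inv_cancel S hS0
  have : P * S⁻¹ = 1 := by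
    refine derivative.ext ?_ ?_
    · rw [Derivation.leibniz, derivative_inv', hP, hS, derivative_one]
      simp only [smul_eq_mul]
      linear_combination (-P * Q * S⁻¹) * hu
    · rw [← hu, map_mul, map_mul, h0]
  calc P = P * S⁻¹ * S := by rw [mul_assoc, mul_comm S⁻¹, hu, mul_one]
    _ = S := by rw [this, one_mul]

theorem exists_comp {W : R⟦X⟧} (hW : constantCoeff W = 0) : ∃ σ : R⟦X⟧ →ₐ[R] R⟦X⟧, σ X = W ∧
    (∀ f, constantCoeff (σ f) = constantCoeff f) ∧ ∀ f, d⁄dX R (σ f) = σ (d⁄dX R f) * d⁄dX R W := by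
  have h : HasSubst W := HasSubst.of_constantCoeff_zero' hW
  have hX : substAlgHom (R := R) h X = W := substAlgHom_X h
  refine ⟨substAlgHom h, hX, fun f => ?_, fun f => ?_⟩
  · obtain ⟨g, hg⟩ := X_dvd_iff.2 (show constantCoeff (f - C (constantCoeff f)) = 0 by simp)
    have hC : substAlgHom (R := R) h (C (constantCoeff f)) = C (constantCoeff f) := by
      have := (substAlgHom (R := R) h).commutes (constantCoeff f)
      exact this
    have := congrArg (fun f => constantCoeff (R := R) (substAlgHom (R := R) h f)) hg
    have h2 : constantCoeff (R := R) (substAlgHom (R := R) h (X * g)) = 0 := by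
      rw [map_mul, hX, map_mul, hW, zero_mul]
    simp only [map_sub, h2, hC] at this
    simpa [sub_eq_zero] using this
  · have := derivative_subst (f := f) h
    simpa only [coe_substAlgHom] using this

theorem coeff_X_mul_derivative (f : R⟦X⟧) (n : ℕ) :
    coeff n (X * d⁄dX R f) = n * coeff n f := by
  cases n with
  | zero => simp
  | succ n => rw [coeff_succ_X_mul, coeff_derivative]; push_cast; ring

/-- Integration by parts in the coefficient formula of Lagrange inversion. -/
theorem natCast_mul_coeff_lagrange {φ ψ : R⟦X⟧} (hφ : d⁄dX R φ = d⁄dX R ψ * φ) (H : R⟦X⟧) (n : ℕ) :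
    (n : R) * coeff n (H * φ ^ n * (1 - X * d⁄dX R ψ)) = coeff n (X * d⁄dX R H * φ ^ n) := by
  have h1 : X * d⁄dX R (H * φ ^ n) =
      X * d⁄dX R H * φ ^ n + (n : R) • (H * φ ^ n * (X * d⁄dX R ψ)) := by
    rw [Derivation.leibniz, Derivation.leibniz_pow, hφ, Nat.cast_smul_eq_nsmul]
    simp only [smul_eq_mul, nsmul_eq_mul]
    rcases n with _ | n
    · simp
    · simp only [Nat.add_sub_cancel, pow_succ]; ring
  have h2 := coeff_X_mul_derivative (H * φ ^ n) n
  rw [h1, map_add, coeff_smul, smul_eq_mul] at h2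
  rw [mul_sub, mul_one, map_sub]
  linear_combination -h2

theorem coeff_lagrange [CharZero R] {φ ψ W : R⟦X⟧} (hφ : d⁄dX R φ = d⁄dX R ψ * φ)
    {σ : R⟦X⟧ →ₐ[R] R⟦X⟧} (hσX : σ X = W) (hσ0 : ∀ f, constantCoeff (σ f) = constantCoeff f)
    (hW : W = X * σ φ) (H : R⟦X⟧) (n : ℕ) :
    coeff n (σ H) = coeff n (H * φ ^ n * (1 - X * d⁄dX R ψ)) := by
  induction n generalizing H with
  | zero => simp [hσ0]
  | succ n ih =>
    obtain ⟨K, hK⟩ := X_dvd_iff.2 (show constantCoeff (H - C (constantCoeff H)) = 0 by simp)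
    obtain ⟨c, rfl⟩ : ∃ c, H = C c + X * K := ⟨constantCoeff H, by rw [← hK]; ring⟩
    have hC : σ (C c) = C c := σ.commutes c
    have h1 : coeff (n + 1) (C c * φ ^ (n + 1) * (1 - X * d⁄dX R ψ)) = 0 := by
      have := natCast_mul_coeff_lagrange hφ (C c) (n + 1)
      rw [derivative_C, mul_zero, zero_mul, map_zero] at this
      exact (mul_eq_zero.1 this).resolve_left (Nat.cast_ne_zero.2 n.succ_ne_zero)
    have h2 : σ (C c + X * K) = C c + X * σ (φ * K) := by
      rw [map_add, map_mul, hσX, hC, map_mul]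
      nth_rw 1 [hW]
      ring
    rw [h2, map_add, coeff_succ_X_mul, ih, add_mul, add_mul, map_add, h1, zero_add,
      show X * K * φ ^ (n + 1) * (1 - X * d⁄dX R ψ) =
        X * (φ * K * φ ^ n * (1 - X * d⁄dX R ψ)) by ring, coeff_succ_X_mul]
    simp

end PowerSeries

end

section

open PowerSeries

/-- The exponential generating function of a counting sequence. -/
noncomputable def egf (u : ℕ → ℕ) : ℂ⟦X⟧ := mk fun n => (u n : ℂ) / n.factorial

theorem egf_mul {u v w : ℕ → ℕ}
    (h : ∀ n, w n = ∑ k ∈ Finset.range (n + 1), n.choose k * (u (n - k) * v k)) :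
    egf w = egf u * egf v := by
  ext n
  rw [mul_comm, coeff_mul, Finset.Nat.sum_antidiagonal_eq_sum_range_succ_mk]
  simp only [egf, coeff_mk, h, Nat.cast_sum, Finset.sum_div]
  refine Finset.sum_congr rfl fun k hk => ?_
  have hk' : k ≤ n := Nat.lt_succ_iff.1 (Finset.mem_range.1 hk)
  have := Nat.choose_mul_factorial_mul_factorial hk'
  have h1 : (k.factorial : ℂ) ≠ 0 := mod_cast k.factorial_ne_zero
  have h2 : ((n - k).factorial : ℂ) ≠ 0 := mod_cast (n - k).factorial_ne_zero
  have h3 : (n.factorial : ℂ) ≠ 0 := mod_cast n.factorial_ne_zero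
  have h4 : (n.choose k : ℂ) * k.factorial * (n - k).factorial = n.factorial := mod_cast this
  push_cast
  rw [div_mul_div_comm, div_eq_div_iff h3 (mul_ne_zero h1 h2), ← h4]
  ring

theorem derivative_egf (u : ℕ → ℕ) : d⁄dX ℂ (egf u) = egf fun n => u (n + 1) := by
  ext n
  rw [coeff_derivative]
  simp only [egf, coeff_mk, Nat.factorial_succ, Nat.cast_mul]
  have : ((n + 1 : ℕ) : ℂ) ≠ 0 := mod_cast n.succ_ne_zero
  have h3 : (n.factorial : ℂ) ≠ 0 := mod_cast n.factorial_ne_zero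
  push_cast at *
  field_simp

theorem derivative_X_mul_egf (u : ℕ → ℕ) :
    d⁄dX ℂ (X * egf u) = egf fun n => (n + 1) * u n := by
  ext n
  rw [coeff_derivative, coeff_succ_X_mul]
  simp only [egf, coeff_mk]
  push_cast
  ring

theorem constantCoeff_egf (u : ℕ → ℕ) : constantCoeff (egf u) = u 0 := by
  rw [← coeff_zero_eq_constantCoeff_apply]
  simp [egf]

/-- The exponential generating function of rooted tree configurations, divided by `X`. -/
noncomputable def treeSeries (Q : Prop → Prop → Prop) : ℂ⟦X⟧ := egf fun n => treeCount Q (n + 1)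

theorem derivative_treeSeries {P Q : Prop → Prop → Prop}
    (h : ∀ j₁ d₁ j₂ d₂ : Prop, (P j₁ (d₁ ∨ j₂) ∧ ¬ (j₁ ∧ j₂) ∧ (j₂ ∨ j₁ ∨ d₂)) ↔
      P j₁ d₁ ∧ Q j₂ d₂) :
    d⁄dX ℂ (treeSeries P) = treeSeries P * d⁄dX ℂ (X * treeSeries Q) := by
  rw [treeSeries, treeSeries, derivative_X_mul_egf, derivative_egf]
  refine egf_mul fun n => ?_
  rw [treeCount_add_two h]
  refine Finset.sum_congr rfl fun k hk => ?_
  have hk' : k ≤ n := Nat.lt_succ_iff.1 (Finset.mem_range.1 hk)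
  rw [Nat.sub_add_comm hk']
  ring

theorem treeSeries_add {P Q S : Prop → Prop → Prop} (h : ∀ j d, S j d ↔ P j d ∨ Q j d)
    (hd : ∀ j d, P j d → ¬ Q j d) : treeSeries S = treeSeries P + treeSeries Q := by
  ext n
  simp [treeSeries, egf, treeCount_add h hd, add_div]

/-- The generating functions `A`, `B`, `W`, `C`, all divided by `X`, of rooted trees whose root is
selected, is not selected, is neither selected nor dominated, is dominated. -/
theorem exists_treeSeries : ∃ A B W C : ℂ⟦X⟧,
    d⁄dX ℂ A = A * d⁄dX ℂ (X * B) ∧ d⁄dX ℂ W = W * d⁄dX ℂ (X * C) ∧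
    d⁄dX ℂ B = B * d⁄dX ℂ (X * (A + C)) ∧ B = C + W ∧
    constantCoeff A = 1 ∧ constantCoeff B = 1 ∧ constantCoeff W = 1 ∧
    d⁄dX ℂ (egf forestCount) = egf forestCount * (A + C) ∧
    egf selectedCount = egf forestCount * A := by
  have hT : treeSeries (fun j d => j ∨ d) =
      treeSeries (fun j _ => j) + treeSeries (fun j d => ¬ j ∧ d) :=
    treeSeries_add (fun j d => by tauto) (fun j d => by tauto)
  refine ⟨treeSeries fun j _ => j, treeSeries fun j _ => ¬ j, treeSeries fun j d => ¬ j ∧ ¬ d,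
    treeSeries fun j d => ¬ j ∧ d, derivative_treeSeries fun j₁ d₁ j₂ d₂ => by tauto,
    derivative_treeSeries fun j₁ d₁ j₂ d₂ => by tauto, ?_, ?_, ?_, ?_, ?_, ?_, ?_⟩
  · rw [← hT]
    exact derivative_treeSeries fun j₁ d₁ j₂ d₂ => by tauto
  · exact treeSeries_add (fun j d => by tauto) (fun j d => by tauto)
  · rw [treeSeries, constantCoeff_egf, treeCount_one_in, Nat.cast_one]
  · rw [treeSeries, constantCoeff_egf, treeCount_one_out (by simp) fun _ _ h => h, Nat.cast_one]
  · rw [treeSeries, constantCoeff_egf, treeCount_one_out (by simp) fun _ _ h => h.1, Nat.cast_one]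
  · rw [← hT, derivative_egf]
    exact egf_mul forestCount_add_one
  · exact egf_mul fun n => rfl

theorem exists_composition {e α ε ψ φ G : ℂ⟦X⟧} (he : d⁄dX ℂ e = e) (he0 : constantCoeff e = 1)
    (hα : α = X * e) (hε : d⁄dX ℂ ε = d⁄dX ℂ α * ε) (hε0 : constantCoeff ε = 1)
    (hψ : ψ = X * (ε - 1)) (hφ : d⁄dX ℂ φ = d⁄dX ℂ ψ * φ) (hφ0 : constantCoeff φ = 1)
    (hG : X * d⁄dX ℂ G = (α + ψ) * (1 - X * d⁄dX ℂ ψ) * G) (hG0 : constantCoeff G = 1) :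
    ∃ (W : ℂ⟦X⟧) (σ : ℂ⟦X⟧ →ₐ[ℂ] ℂ⟦X⟧), σ X = W ∧ (∀ f, constantCoeff (σ f) = constantCoeff f) ∧
      W = X * σ φ ∧ egf forestCount = σ G ∧
      X * d⁄dX ℂ (egf forestCount) = σ ((α + ψ) * G) ∧
      X * egf selectedCount = σ (α * G) := by
  obtain ⟨A, B, W, C', dA, dB, dW, hB, hA0, hB0, hW0, hI, hS⟩ := exists_treeSeries
  obtain ⟨σ, hσX, hσ0, hσd⟩ := exists_comp (R := ℂ) (W := X * W) (by simp)
  have h1 : A = W * σ e := by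
    refine eq_of_derivative_eq_mul dA ?_ (by simp [hA0, hW0, hσ0, he0]) (by simp [hW0, hσ0, he0])
    rw [Derivation.leibniz, hσd, he, dB, hB, mul_add, map_add]
    simp only [smul_eq_mul]
    ring
  have hAα : X * A = σ α := by rw [hα, map_mul, hσX, h1]; ring
  have h2 : B = W * σ ε := by
    refine eq_of_derivative_eq_mul dW ?_ (by simp [hB0, hW0, hσ0, hε0]) (by simp [hW0, hσ0, hε0])
    rw [Derivation.leibniz, hσd, hε, map_mul, mul_add, map_add, dB, hAα, hσd α]
    simp only [smul_eq_mul]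
    ring
  have hCψ : X * C' = σ ψ := by
    rw [hψ, map_mul, hσX, map_sub, map_one, eq_sub_of_add_eq hB.symm, h2]
    ring
  have h3 : W = σ φ := by
    refine eq_of_derivative_eq_mul dB ?_ (by simp [hW0, hσ0, hφ0]) (by simp [hσ0, hφ0])
    rw [hσd, hφ, map_mul, hCψ, hσd ψ]
    ring
  have hW1 : d⁄dX ℂ (X * W) * (1 - σ (X * d⁄dX ℂ ψ)) = W := by
    have : d⁄dX ℂ (X * W) = W + X * W * (σ (d⁄dX ℂ ψ) * d⁄dX ℂ (X * W)) := by
      nth_rw 1 [Derivation.leibniz]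
      rw [dB, hCψ, hσd, derivative_X]
      simp only [smul_eq_mul]
      ring
    rw [map_mul σ, hσX]
    linear_combination this
  have hGI : egf forestCount = σ G := by
    refine eq_of_derivative_eq_mul hI ?_ ?_ (by simp [hσ0, hG0])
    · have hne : X * (X * W) ≠ 0 := by
        have : W ≠ 0 := fun h => by simp [h] at hW0
        exact mul_ne_zero X_ne_zero (mul_ne_zero X_ne_zero this)
      refine mul_left_cancel₀ hne ?_
      have := congrArg σ hG
      rw [map_mul, map_mul, map_mul, hσX, map_sub, map_one, map_add, ← hAα, ← hCψ] at this
      rw [hσd]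
      linear_combination (X * d⁄dX ℂ (X * W)) * this + X * X * (A + C') * σ G * hW1
    · rw [constantCoeff_egf, forestCount_zero, hσ0, hG0, Nat.cast_one]
  refine ⟨X * W, σ, hσX, hσ0, by rw [← h3], hGI, ?_, ?_⟩
  · rw [hI, map_mul, map_add, ← hGI, ← hAα, ← hCψ]
    ring
  · rw [hS, map_mul, ← hGI, ← hAα]
    ring

/-- The deviation `En n - μ n` as a quotient of coefficients. -/
theorem En_sub_mul_coeff {e α ε ψ φ G : ℂ⟦X⟧} (he : d⁄dX ℂ e = e) (he0 : constantCoeff e = 1)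
    (hα : α = X * e) (hε : d⁄dX ℂ ε = d⁄dX ℂ α * ε) (hε0 : constantCoeff ε = 1)
    (hψ : ψ = X * (ε - 1)) (hφ : d⁄dX ℂ φ = d⁄dX ℂ ψ * φ) (hφ0 : constantCoeff φ = 1)
    (hG : X * d⁄dX ℂ G = (α + ψ) * (1 - X * d⁄dX ℂ ψ) * G) (hG0 : constantCoeff G = 1)
    (μ : ℝ) {H H₁ : ℂ⟦X⟧} (hH : H = (α - (μ : ℂ) • (α + ψ)) * G)
    (hH₁ : X * d⁄dX ℂ H = (1 - X * d⁄dX ℂ ψ) * H₁) (m : ℕ)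
    (hne : coeff (m + 1) (X * d⁄dX ℂ ((α + ψ) * G) * φ ^ (m + 1)) ≠ 0) :
    ((En (m + 1) - μ * (m + 1 : ℕ) : ℝ) : ℂ) =
      coeff (m + 1) (X * d⁄dX ℂ H₁ * φ ^ (m + 1)) /
        coeff (m + 1) (X * d⁄dX ℂ ((α + ψ) * G) * φ ^ (m + 1)) := by
  obtain ⟨W, σ, hσX, hσ0, hW, -, hI', hS⟩ :=
    exists_composition he he0 hα hε hε0 hψ hφ hφ0 hG hG0
  have lag := fun K => coeff_lagrange hφ hσX hσ0 hW K (m + 1)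
  have ibp := fun K => natCast_mul_coeff_lagrange hφ K (m + 1)
  set N : ℂ := ((m + 1 : ℕ) : ℂ) with hN
  set g := coeff (m + 1) (egf forestCount) with hg
  have hN0 : N ≠ 0 := Nat.cast_ne_zero.2 m.succ_ne_zero
  have e1 : N * (N * g) = coeff (m + 1) (X * d⁄dX ℂ ((α + ψ) * G) * φ ^ (m + 1)) := by
    rw [← ibp, ← lag, ← hI', coeff_X_mul_derivative]
  have hg0 : g ≠ 0 := fun h => hne (by rw [← e1, h]; simp)
  have e2 : N * (N * coeff (m + 1) (σ H)) = coeff (m + 1) (X * d⁄dX ℂ H₁ * φ ^ (m + 1)) := by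
    rw [lag H, ibp H, hH₁, ← ibp H₁]
    congr 2
    ring
  have e3 : coeff (m + 1) (σ H) = (En (m + 1) - μ * (m + 1 : ℕ) : ℝ) * g := by
    have : H = α * G - (μ : ℂ) • ((α + ψ) * G) := by
      rw [hH, sub_mul, smul_mul_assoc]
    rw [this, map_sub σ, map_smul σ, ← hI', ← hS, map_sub, coeff_smul, coeff_X_mul_derivative,
      coeff_succ_X_mul, ← hg]
    have hEn : ((En (m + 1) : ℝ) : ℂ) * g = coeff m (egf selectedCount) := by
      have h3 : ((m + 1).factorial : ℂ) ≠ 0 := mod_cast (m + 1).factorial_ne_zero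
      have h4 : (m.factorial : ℂ) ≠ 0 := mod_cast m.factorial_ne_zero
      have h5 : (forestCount (m + 1) : ℂ) ≠ 0 := by
        intro h
        rw [hg, egf, coeff_mk, h] at hg0
        simp at hg0
      rw [hg, egf, egf, coeff_mk, coeff_mk, En_eq]
      rw [Nat.factorial_succ] at *
      push_cast at *
      have h6 : (m : ℂ) + 1 ≠ 0 := left_ne_zero_of_mul h3
      field_simp
    push_cast [smul_eq_mul] at *
    linear_combination -hEn
  rw [← e1, ← e2, e3]
  field_simp

end

section

open PowerSeries
open scoped Nat

/-- The Taylor series at `0` of a complex function. -/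
noncomputable def taylorSeriesAtZero (f : ℂ → ℂ) : ℂ⟦X⟧ :=
  PowerSeries.mk fun n => iteratedDeriv n f 0 / n !

section taylorSeriesAtZero

variable {f g : ℂ → ℂ}

theorem coeff_taylorSeriesAtZero (f : ℂ → ℂ) (n : ℕ) :
    coeff n (taylorSeriesAtZero f) = iteratedDeriv n f 0 / n ! :=
  coeff_mk _ _

theorem constantCoeff_taylorSeriesAtZero (f : ℂ → ℂ) :
    constantCoeff (taylorSeriesAtZero f) = f 0 := by
  rw [← coeff_zero_eq_constantCoeff_apply, coeff_taylorSeriesAtZero]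
  simp

theorem taylorSeriesAtZero_const (c : ℂ) : taylorSeriesAtZero (fun _ => c) = C c := by
  ext n
  rw [coeff_taylorSeriesAtZero, iteratedDeriv_const, coeff_C]
  split_ifs with h <;> simp [h]

theorem taylorSeriesAtZero_add (hf : AnalyticAt ℂ f 0) (hg : AnalyticAt ℂ g 0) :
    taylorSeriesAtZero (f + g) = taylorSeriesAtZero f + taylorSeriesAtZero g := by
  ext n
  rw [map_add, coeff_taylorSeriesAtZero, coeff_taylorSeriesAtZero, coeff_taylorSeriesAtZero,
    iteratedDeriv_add hf.contDiffAt hg.contDiffAt, add_div]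

theorem taylorSeriesAtZero_sub (hf : AnalyticAt ℂ f 0) (hg : AnalyticAt ℂ g 0) :
    taylorSeriesAtZero (f - g) = taylorSeriesAtZero f - taylorSeriesAtZero g := by
  ext n
  rw [map_sub, coeff_taylorSeriesAtZero, coeff_taylorSeriesAtZero, coeff_taylorSeriesAtZero,
    iteratedDeriv_sub hf.contDiffAt hg.contDiffAt, sub_div]

theorem taylorSeriesAtZero_mul (hf : AnalyticAt ℂ f 0) (hg : AnalyticAt ℂ g 0) :
    taylorSeriesAtZero (f * g) = taylorSeriesAtZero f * taylorSeriesAtZero g := by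
  ext n
  rw [coeff_mul, coeff_taylorSeriesAtZero, iteratedDeriv_mul hf.contDiffAt hg.contDiffAt,
    Finset.Nat.sum_antidiagonal_eq_sum_range_succ_mk, Finset.sum_div]
  refine Finset.sum_congr rfl fun k hk => ?_
  have hk : k ≤ n := by simpa [Nat.lt_succ_iff] using hk
  simp only [coeff_taylorSeriesAtZero]
  rw [Nat.cast_choose ℂ hk]
  have h1 : ((n ! : ℕ) : ℂ) ≠ 0 := by exact_mod_cast n.factorial_ne_zero
  have h2 : ((k ! : ℕ) : ℂ) ≠ 0 := by exact_mod_cast k.factorial_ne_zero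
  have h3 : (((n - k)! : ℕ) : ℂ) ≠ 0 := by exact_mod_cast (n - k).factorial_ne_zero
  field_simp

theorem taylorSeriesAtZero_pow (hf : AnalyticAt ℂ f 0) (n : ℕ) :
    taylorSeriesAtZero (f ^ n) = taylorSeriesAtZero f ^ n := by
  induction n with
  | zero => simpa [Pi.one_def] using taylorSeriesAtZero_const 1
  | succ n ih => rw [pow_succ, pow_succ, taylorSeriesAtZero_mul (hf.pow n) hf, ih]

theorem taylorSeriesAtZero_smul (c : ℂ) (hf : AnalyticAt ℂ f 0) :
    taylorSeriesAtZero (c • f) = c • taylorSeriesAtZero f := by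
  ext n
  rw [coeff_smul, coeff_taylorSeriesAtZero, coeff_taylorSeriesAtZero,
    iteratedDeriv_const_smul hf.contDiffAt, smul_eq_mul, smul_eq_mul, mul_div_assoc]

theorem taylorSeriesAtZero_deriv (f : ℂ → ℂ) :
    taylorSeriesAtZero (deriv f) = d⁄dX ℂ (taylorSeriesAtZero f) := by
  ext n
  rw [coeff_derivative, coeff_taylorSeriesAtZero, coeff_taylorSeriesAtZero, iteratedDeriv_succ',
    Nat.factorial_succ]
  have h1 : ((n ! : ℕ) : ℂ) ≠ 0 := by exact_mod_cast n.factorial_ne_zero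
  have h2 : ((n : ℂ) + 1) ≠ 0 := by exact_mod_cast n.succ_ne_zero
  push_cast
  field_simp

theorem taylorSeriesAtZero_id : taylorSeriesAtZero (fun z => z) = X := by
  ext n
  rcases n with _ | n
  · rw [coeff_taylorSeriesAtZero]; simp
  · rw [coeff_taylorSeriesAtZero, iteratedDeriv_succ', deriv_id'', iteratedDeriv_const, coeff_X]
    rcases n with _ | n <;> simp

theorem coeff_taylorSeriesAtZero_eq_intervalIntegral {r : ℝ} (hr : 0 < r)
    (hf : DifferentiableOn ℂ f (Metric.closedBall 0 r)) (n : ℕ) :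
    coeff n (taylorSeriesAtZero f) = (2 * Real.pi : ℂ)⁻¹ * ∫ θ in (-Real.pi)..Real.pi,
      f (circleMap 0 r θ) * (circleMap 0 r θ)⁻¹ ^ n := by
  lift r to NNReal using hr.le
  have hr' : 0 < r := by exact_mod_cast hr
  have h1 := hf.hasFPowerSeriesOnBall hr'
  have h2 : AnalyticAt ℂ f 0 := h1.analyticAt
  have h3 := h1.hasFPowerSeriesAt.eq_formalMultilinearSeries h2.hasFPowerSeriesAt
  have h4 : coeff n (taylorSeriesAtZero f) = (cauchyPowerSeries f 0 r).coeff n := by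
    rw [h3, FormalMultilinearSeries.coeff_ofScalars, coeff_taylorSeriesAtZero]
  have h5 := cauchyPowerSeries_apply f 0 r n 1
  have h6 : (cauchyPowerSeries f 0 r).coeff n = cauchyPowerSeries f 0 r n fun _ => 1 := rfl
  rw [h4, h6, h5, circleIntegral]
  have h7 : (fun θ : ℝ => deriv (circleMap 0 (r : ℝ)) θ • (((1 : ℂ) / (circleMap 0 r θ - 0)) ^ n •
      (circleMap 0 r θ - 0)⁻¹ • f (circleMap 0 r θ))) = fun θ : ℝ => Complex.I *
        (f (circleMap 0 r θ) * (circleMap 0 r θ)⁻¹ ^ n) := by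
    funext θ
    have h0 : circleMap 0 r θ ≠ 0 := circleMap_ne_center hr.ne'
    simp only [deriv_circleMap, sub_zero, one_div, smul_eq_mul]
    field_simp
  have h8 : Function.Periodic (fun θ : ℝ => f (circleMap 0 r θ) * (circleMap 0 r θ)⁻¹ ^ n)
      (2 * Real.pi) := fun θ => by simp only [periodic_circleMap 0 (r : ℝ) θ]
  have h9 := h8.intervalIntegral_add_eq 0 (-Real.pi)
  rw [zero_add, show -Real.pi + 2 * Real.pi = Real.pi by ring] at h9
  rw [h7, intervalIntegral.integral_const_mul, h9, smul_eq_mul]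
  have := Complex.I_ne_zero
  have := Real.pi_ne_zero
  field_simp

end taylorSeriesAtZero

end

section

/-- **Laplace's method** on `[-π, π]` for an exponent with a quadratic maximum at `0`. -/
theorem tendsto_sqrt_mul_integral_exp {F κ : ℝ → ℂ} (hF : Continuous F) (hκ : Continuous κ)
    {c : ℝ} (hc : 0 < c) {s : ℂ}
    (hκc : ∀ θ, |θ| ≤ Real.pi → (κ θ).re ≤ -c * θ ^ 2) (hκ0 : κ 0 = 0)
    (hκ2 : Tendsto (fun θ : ℝ => κ θ / (θ : ℂ) ^ 2) (𝓝[≠] 0) (𝓝 (-s))) :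
    Tendsto (fun n : ℕ => (√n : ℂ) * ∫ θ in (-Real.pi)..Real.pi, F θ * Complex.exp (n * κ θ))
      atTop (𝓝 (F 0 * ∫ t : ℝ, Complex.exp (-s * (t : ℂ) ^ 2))) := by
  obtain ⟨M, hM⟩ := (isCompact_Icc (a := -Real.pi) (b := Real.pi)).exists_bound_of_continuousOn
    hF.continuousOn
  set g : ℕ → ℝ → ℂ := fun n t => (Set.Ioc (-(Real.pi * √n)) (Real.pi * √n)).indicator
    (fun t : ℝ => F (t / √n) * Complex.exp (n * κ (t / √n))) t with hg
  have hlim : Tendsto (fun n => ∫ t, g n t) atTop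
      (𝓝 (∫ t : ℝ, F 0 * Complex.exp (-s * (t : ℂ) ^ 2))) := by
    refine tendsto_integral_filter_of_dominated_convergence
      (fun t => M * Real.exp (-c * t ^ 2)) ?_ ?_ ?_ ?_
    · refine Eventually.of_forall fun n => ?_
      refine AEStronglyMeasurable.indicator ?_ measurableSet_Ioc
      exact Continuous.aestronglyMeasurable (by fun_prop)
    · filter_upwards [eventually_gt_atTop 0] with n hn
      refine Eventually.of_forall fun t => ?_
      have hn' : (0 : ℝ) < √n := Real.sqrt_pos.2 (by exact_mod_cast hn)
      have hM0 : 0 ≤ M := (norm_nonneg _).trans (hM 0 ⟨by linarith [Real.pi_pos], Real.pi_pos.le⟩)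
      by_cases ht : t ∈ Set.Ioc (-(Real.pi * √n)) (Real.pi * √n)
      · have h1 : |t / √n| ≤ Real.pi := by
          rw [abs_le, le_div_iff₀ hn', div_le_iff₀ hn']
          exact ⟨by linarith [ht.1], ht.2⟩
        rw [hg]
        simp only [Set.indicator_of_mem ht, norm_mul, Complex.norm_exp]
        refine mul_le_mul (hM _ (abs_le.1 h1)) ?_ (Real.exp_pos _).le hM0
        refine Real.exp_le_exp.2 ?_
        have h2 := hκc _ h1
        have h3 : ((n : ℂ) * κ (t / √n)).re = n * (κ (t / √n)).re := by simp
        rw [h3]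
        have h4 : (t / √n) ^ 2 = t ^ 2 / n := by
          rw [div_pow, Real.sq_sqrt (Nat.cast_nonneg n)]
        rw [h4] at h2
        have hn0 : (0 : ℝ) < n := by exact_mod_cast hn
        calc (n : ℝ) * (κ (t / √n)).re ≤ n * (-c * (t ^ 2 / n)) := by gcongr
          _ = _ := by field_simp
      · rw [hg]
        simp only [Set.indicator_of_notMem ht, norm_zero]
        positivity
    · exact (integrable_exp_neg_mul_sq hc).const_mul M
    · refine Eventually.of_forall fun t => ?_
      have hs : Tendsto (fun n : ℕ => √(n : ℝ)) atTop atTop :=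
        Real.tendsto_sqrt_atTop.comp tendsto_natCast_atTop_atTop
      have hu : Tendsto (fun n : ℕ => t / √(n : ℝ)) atTop (𝓝 0) := hs.const_div_atTop t
      have hmem : ∀ᶠ n : ℕ in atTop, t ∈ Set.Ioc (-(Real.pi * √n)) (Real.pi * √n) := by
        filter_upwards [hs.eventually_gt_atTop (|t| / Real.pi)] with n hn
        rw [div_lt_iff₀ Real.pi_pos, mul_comm] at hn
        exact ⟨(abs_lt.1 hn).1, (abs_lt.1 hn).2.le⟩
      have hF0 : Tendsto (fun n : ℕ => F (t / √(n : ℝ))) atTop (𝓝 (F 0)) :=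
        (hF.tendsto 0).comp hu
      have hexp : Tendsto (fun n : ℕ => (n : ℂ) * κ (t / √(n : ℝ))) atTop
          (𝓝 (-s * (t : ℂ) ^ 2)) := by
        by_cases ht : t = 0
        · simp [ht, hκ0]
        · have hu' : Tendsto (fun n : ℕ => t / √(n : ℝ)) atTop (𝓝[≠] 0) := by
            refine tendsto_nhdsWithin_iff.2 ⟨hu, ?_⟩
            filter_upwards [eventually_gt_atTop 0] with n hn
            have : (0 : ℝ) < √n := Real.sqrt_pos.2 (by exact_mod_cast hn)
            exact div_ne_zero ht this.ne'
          refine ((hκ2.comp hu').mul_const ((t : ℂ) ^ 2)).congr' ?_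
          filter_upwards [eventually_gt_atTop 0] with n hn
          have h1 : ((√(n : ℝ) : ℝ) : ℂ) ^ 2 = n := by
            rw [← Complex.ofReal_pow, Real.sq_sqrt (Nat.cast_nonneg n), Complex.ofReal_natCast]
          have h2 : (n : ℂ) ≠ 0 := by exact_mod_cast hn.ne'
          have h3 : (t : ℂ) ≠ 0 := by exact_mod_cast ht
          simp only [Function.comp_apply]
          push_cast
          rw [div_pow, h1]
          field_simp
      have := hF0.mul ((Complex.continuous_exp.tendsto _).comp hexp)
      refine this.congr' ?_
      filter_upwards [hmem] with n hn
      rw [hg]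
      simp only [Set.indicator_of_mem hn, Function.comp_apply]
  rw [integral_const_mul] at hlim
  refine hlim.congr' ?_
  filter_upwards [eventually_gt_atTop 0] with n hn
  have hn' : (0 : ℝ) < √n := Real.sqrt_pos.2 (by exact_mod_cast hn)
  rw [hg]
  simp only
  rw [integral_indicator measurableSet_Ioc,
    ← intervalIntegral.integral_of_le (by nlinarith [Real.pi_pos]),
    intervalIntegral.integral_comp_div (fun θ => F θ * Complex.exp (n * κ θ)) hn'.ne',
    neg_div, mul_div_cancel_right₀ _ hn'.ne', Complex.real_smul]

end

section

open PowerSeries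

theorem tendsto_div_sq_of_hasDerivAt {κ κ' : ℝ → ℂ} {m : ℂ} (hκ : ∀ θ, HasDerivAt κ (κ' θ) θ)
    (hκ0 : κ 0 = 0) (hκ'0 : κ' 0 = 0) (hm : HasDerivAt κ' m 0) :
    Tendsto (fun θ : ℝ => κ θ / (θ : ℂ) ^ 2) (𝓝[≠] 0) (𝓝 (m / 2)) := by
  rw [Metric.tendsto_nhds]
  intro ε hε
  have h1 := (hasDerivAt_iff_isLittleO.1 hm).def (half_pos hε)
  obtain ⟨δ, hδ, hball⟩ := Metric.eventually_nhds_iff.1 h1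
  have hmem : ∀ᶠ θ : ℝ in 𝓝[≠] 0, dist θ 0 < δ :=
    eventually_nhdsWithin_of_eventually_nhds (Metric.ball_mem_nhds 0 hδ)
  filter_upwards [hmem, self_mem_nhdsWithin] with θ hθ hne
  have hne : θ ≠ 0 := hne
  rw [Real.dist_eq, sub_zero] at hθ
  have key := (convex_closedBall (0 : ℝ) |θ|).norm_image_sub_le_of_norm_hasDerivWithin_le
    (f := fun x : ℝ => κ x - m / 2 * (x : ℂ) ^ 2) (f' := fun x : ℝ => κ' x - m * x)
    (C := ε / 2 * |θ|) (x := 0) (y := θ) ?_ ?_ (by simp) (by simp)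
  · have h2 : (θ : ℂ) ≠ 0 := by exact_mod_cast hne
    have h3 : κ θ / (θ : ℂ) ^ 2 - m / 2 = (κ θ - m / 2 * (θ : ℂ) ^ 2) / (θ : ℂ) ^ 2 := by
      field_simp
    rw [dist_eq_norm, h3, norm_div, norm_pow, Complex.norm_real, Real.norm_eq_abs,
      div_lt_iff₀ (by positivity)]
    have h4 : ‖κ θ - m / 2 * (θ : ℂ) ^ 2‖ ≤ ε / 2 * |θ| * |θ| := by simpa [hκ0] using key
    have h5 : 0 < ε * (|θ| ^ 2) := by positivity
    nlinarith
  · intro x _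
    have h2 : HasDerivAt (fun x : ℝ => (x : ℂ) ^ 2) (2 * (x : ℂ)) x := by
      simpa [Pi.pow_def] using! (Complex.ofRealCLM.hasDerivAt (x := x)).pow 2
    convert! ((hκ x).sub (h2.const_mul (m / 2))).hasDerivWithinAt using 1
    ring
  · intro x hx
    have hx' : |x| ≤ |θ| := by simpa using hx
    have h2 := hball (y := x) (by rw [Real.dist_eq, sub_zero]; exact hx'.trans_lt hθ)
    simp only [hκ'0, sub_zero, Complex.real_smul, Real.norm_eq_abs] at h2
    rw [mul_comm m]
    exact h2.trans (by gcongr)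

theorem hasDerivAt_comp_circleMap {f : ℂ → ℂ} (hf : Differentiable ℂ f) (r θ : ℝ) :
    HasDerivAt (fun θ : ℝ => f (circleMap 0 r θ))
      (Complex.I * (circleMap 0 r θ * deriv f (circleMap 0 r θ))) θ := by
  have h := (hf (circleMap 0 r θ)).hasDerivAt.comp θ (hasDerivAt_circleMap 0 r θ)
  convert! h using 1
  ring

/-- The saddle-point asymptotics of `[w ^ n] f(w) exp (n ψ(w))`, with a normalization that does
not depend on `f`. -/
theorem exists_tendsto_mul_coeff_taylorSeriesAtZero {ψ : ℂ → ℂ} (hψ : Differentiable ℂ ψ) {τ : ℝ}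
    (hτ : 0 < τ) (hψτ : τ * deriv ψ τ = 1) {c : ℝ} (hc : 0 < c)
    (hre : ∀ θ, |θ| ≤ Real.pi → (ψ (circleMap 0 τ θ)).re ≤ (ψ τ).re - c * θ ^ 2)
    (hs : 0 < (τ * deriv (fun w => w * deriv ψ w) τ).re) :
    ∃ a : ℕ → ℂ, ∀ f : ℂ → ℂ, DifferentiableOn ℂ f (Metric.closedBall 0 τ) →
      Tendsto (fun n => a n * coeff n (taylorSeriesAtZero fun w => f w * Complex.exp (ψ w) ^ n))
        atTop (𝓝 (f τ)) := by
  set s : ℂ := τ * deriv (fun w => w * deriv ψ w) τ / 2 with hsdef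
  have hs' : 0 < s.re := by
    rw [hsdef, Complex.div_ofNat_re]
    positivity
  set g : ℂ := ∫ t : ℝ, Complex.exp (-s * (t : ℂ) ^ 2) with hg
  have hg0 : g ≠ 0 := by
    rw [hg, integral_gaussian_complex hs']
    have h1 : s ≠ 0 := fun h => by simp [h] at hs'
    have h2 : (Real.pi : ℂ) / s ≠ 0 := div_ne_zero (by exact_mod_cast Real.pi_ne_zero) h1
    simp [Complex.cpow_eq_zero_iff, h2]
  have hτ0 : (τ : ℂ) ≠ 0 := by exact_mod_cast hτ.ne'
  have hdψ : Differentiable ℂ (deriv ψ) := hψ.deriv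
  have hP : Differentiable ℂ (fun w => w * deriv ψ w) := by fun_prop
  set κ : ℝ → ℂ := fun θ => ψ (circleMap 0 τ θ) - ψ τ - Complex.I * θ with hκ
  have hκd : ∀ θ : ℝ, HasDerivAt κ
      (Complex.I * (circleMap 0 τ θ * deriv ψ (circleMap 0 τ θ)) - Complex.I) θ := by
    intro θ
    have h1 : HasDerivAt (fun x : ℝ => Complex.I * (x : ℂ)) Complex.I θ := by
      simpa using (Complex.ofRealCLM.hasDerivAt (x := θ)).const_mul Complex.I
    exact ((hasDerivAt_comp_circleMap hψ τ θ).sub_const _).sub h1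
  have hc0 : circleMap 0 τ 0 = τ := by simp [circleMap]
  have hκ0 : κ 0 = 0 := by simp [hκ, hc0]
  have hκ2 : Tendsto (fun θ : ℝ => κ θ / (θ : ℂ) ^ 2) (𝓝[≠] 0) (𝓝 (-s)) := by
    have h1 := ((hasDerivAt_comp_circleMap hP τ 0).const_mul Complex.I).sub_const Complex.I
    have h2 := tendsto_div_sq_of_hasDerivAt hκd hκ0 (by simp [hc0, hψτ]) h1
    convert h2 using 2
    rw [hc0, hsdef, ← mul_assoc Complex.I Complex.I, Complex.I_mul_I]
    ring
  have hκc : Continuous κ := continuous_iff_continuousAt.2 fun θ => (hκd θ).continuousAt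
  refine ⟨fun n => (2 * Real.pi) * g⁻¹ * √n * (τ / Complex.exp (ψ τ)) ^ n, fun f hf => ?_⟩
  have hF : Continuous fun θ : ℝ => f (circleMap 0 τ θ) := by
    refine hf.continuousOn.comp_continuous (continuous_circleMap 0 τ) fun θ => ?_
    exact circleMap_mem_closedBall 0 hτ.le θ
  have hmain := (tendsto_sqrt_mul_integral_exp hF hκc hc (fun θ hθ => ?_) hκ0 hκ2).const_mul g⁻¹
  · rw [← hg, hc0, mul_comm (f τ), inv_mul_cancel_left₀ hg0] at hmain
    refine hmain.congr fun n => ?_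
    have hfn : DifferentiableOn ℂ (fun w => f w * Complex.exp (ψ w) ^ n)
        (Metric.closedBall 0 τ) := hf.mul (hψ.cexp.pow n).differentiableOn
    rw [coeff_taylorSeriesAtZero_eq_intervalIntegral hτ hfn]
    have h1 : ∀ θ : ℝ, f (circleMap 0 τ θ) * Complex.exp (ψ (circleMap 0 τ θ)) ^ n *
        (circleMap 0 τ θ)⁻¹ ^ n = (Complex.exp (ψ τ) / τ) ^ n *
          (f (circleMap 0 τ θ) * Complex.exp (n * κ θ)) := by
      intro θ
      have h2 : circleMap 0 τ θ = τ * Complex.exp (Complex.I * θ) := by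
        rw [circleMap, zero_add, mul_comm Complex.I]
      have h3 : Complex.exp (n * κ θ) = Complex.exp (ψ (circleMap 0 τ θ)) ^ n /
          Complex.exp (ψ τ) ^ n / Complex.exp (Complex.I * θ) ^ n := by
        rw [Complex.exp_nat_mul, hκ, Complex.exp_sub, Complex.exp_sub, div_pow, div_pow]
      rw [h3]
      generalize hA : Complex.exp (ψ (circleMap 0 τ θ)) = A
      have h4 := Complex.exp_ne_zero (ψ τ)
      have h5 := Complex.exp_ne_zero (Complex.I * θ)
      generalize f (circleMap 0 τ θ) = B
      rw [h2, inv_pow, mul_pow, div_pow]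
      field_simp
    simp only [h1]
    rw [intervalIntegral.integral_const_mul]
    have h4 := Complex.exp_ne_zero (ψ τ)
    have h6 : (Real.pi : ℂ) ≠ 0 := by exact_mod_cast Real.pi_ne_zero
    generalize (∫ θ in (-Real.pi)..Real.pi, f (circleMap 0 τ θ) * Complex.exp (n * κ θ)) = Y
    simp only [div_pow]
    field_simp
  · have := hre θ hθ
    simp only [hκ, Complex.sub_re, Complex.mul_re, Complex.I_re, Complex.I_im, Complex.ofReal_re,
      Complex.ofReal_im]
    linarith

end

section

open PowerSeries
open scoped ComplexOrder

/-- The coefficients of `p` are nonnegative reals, and positive from degree two on. -/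
def HasPosCoeff (p : ℂ⟦X⟧) : Prop :=
  (∀ n, 0 ≤ coeff n p) ∧ ∀ n, 2 ≤ n → 0 < coeff n p

namespace HasPosCoeff

theorem derivative {p : ℂ⟦X⟧} (hp : HasPosCoeff p) : HasPosCoeff (d⁄dX ℂ p) := by
  refine ⟨fun n => ?_, fun n hn => ?_⟩
  · rw [coeff_derivative]
    exact mul_nonneg (hp.1 _) (by positivity)
  · rw [coeff_derivative]
    exact mul_pos (hp.2 _ (by omega)) (by positivity)

theorem X_mul_derivative {p : ℂ⟦X⟧} (hp : HasPosCoeff p) : HasPosCoeff (X * d⁄dX ℂ p) := by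
  refine ⟨fun n => ?_, fun n hn => ?_⟩
  · rcases n with _ | n
    · simp
    · rw [coeff_succ_X_mul, coeff_derivative]
      exact mul_nonneg (hp.1 _) (by positivity)
  · obtain ⟨n, rfl⟩ : ∃ k, n = k + 1 := ⟨n - 1, by omega⟩
    rw [coeff_succ_X_mul, coeff_derivative]
    exact mul_pos (hp.2 _ hn) (by positivity)

theorem X_mul {p : ℂ⟦X⟧} (hp : ∀ n, 0 < coeff n p) : HasPosCoeff (X * p) := by
  refine ⟨fun n => ?_, fun n hn => ?_⟩
  · rcases n with _ | n
    · simp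
    · simpa using (hp n).le
  · obtain ⟨n, rfl⟩ : ∃ k, n = k + 1 := ⟨n - 1, by omega⟩
    simpa using hp n

theorem X_mul_sub_one {p : ℂ⟦X⟧} (hp : ∀ n, 0 < coeff n p) (h0 : constantCoeff p = 1) :
    HasPosCoeff (X * (p - 1)) := by
  refine ⟨fun n => ?_, fun n hn => ?_⟩
  · rcases n with _ | _ | n
    · simp
    · simp [h0]
    · rw [coeff_succ_X_mul, map_sub, coeff_one, if_neg n.succ_ne_zero, sub_zero]
      exact (hp _).le
  · obtain ⟨n, rfl⟩ : ∃ k, n = k + 1 := ⟨n - 1, by omega⟩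
    rw [coeff_succ_X_mul, map_sub, coeff_one, if_neg (by omega), sub_zero]
    exact hp _

end HasPosCoeff

theorem coeff_pos_of_derivative_eq_mul {p q : ℂ⟦X⟧} (h : d⁄dX ℂ p = q * p)
    (hq : ∀ n, 0 < coeff n q) (h0 : 0 < constantCoeff p) (n : ℕ) : 0 < coeff n p := by
  induction n using Nat.strong_induction_on with
  | _ n ih =>
    rcases n with _ | n
    · simpa using h0
    · have h1 : coeff (n + 1) p * ((n : ℂ) + 1) =
          ∑ x ∈ Finset.HasAntidiagonal.antidiagonal n, coeff x.1 q * coeff x.2 p := by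
        rw [← coeff_derivative, h, coeff_mul]
      have h2 : 0 < ∑ x ∈ Finset.HasAntidiagonal.antidiagonal n, coeff x.1 q * coeff x.2 p :=
        Finset.sum_pos (fun x hx => mul_pos (hq _) (ih _ (by
          have := Finset.HasAntidiagonal.mem_antidiagonal.1 hx; omega))) ⟨(n, 0), by simp⟩
      have h3 : (0 : ℂ) < (((n : ℝ) + 1)⁻¹ : ℝ) := by
        rw [Complex.zero_lt_real]; positivity
      have h4 : ((n : ℂ) + 1) ≠ 0 := by exact_mod_cast n.succ_ne_zero
      have h5 : coeff (n + 1) p = (coeff (n + 1) p * ((n : ℂ) + 1)) * (((n : ℝ) + 1)⁻¹ : ℝ) := by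
        push_cast
        field_simp
      rw [h5, h1]
      exact mul_pos h2 h3

section

variable {f : ℂ → ℂ}

theorem hasSum_coeff_taylorSeriesAtZero (hf : Differentiable ℂ f) (z : ℂ) :
    HasSum (fun n => coeff n (taylorSeriesAtZero f) * z ^ n) (f z) := by
  refine (Complex.hasSum_taylorSeries_of_entire hf 0 z).congr_fun fun n => ?_
  rw [coeff_taylorSeriesAtZero, sub_zero, smul_eq_mul, smul_eq_mul]
  ring

theorem pos_of_hasPosCoeff (hf : Differentiable ℂ f) (hp : HasPosCoeff (taylorSeriesAtZero f))
    {r : ℝ} (hr : 0 < r) : 0 < f r := by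
  have hr' : (0 : ℂ) < r := Complex.zero_lt_real.2 hr
  have h1 := sum_le_hasSum {2}
    (fun n _ => mul_nonneg (hp.1 n) (pow_nonneg hr'.le n)) (hasSum_coeff_taylorSeriesAtZero hf r)
  rw [Finset.sum_singleton] at h1
  exact (mul_pos (hp.2 2 le_rfl) (pow_pos hr' 2)).trans_le h1

theorem hasSum_re_circleMap (hf : Differentiable ℂ f) (hp : HasPosCoeff (taylorSeriesAtZero f))
    (r θ : ℝ) : HasSum (fun n : ℕ => (coeff n (taylorSeriesAtZero f)).re *
      (r ^ n * Real.cos (n * θ))) (f (circleMap 0 r θ)).re := by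
  convert Complex.hasSum_re (hasSum_coeff_taylorSeriesAtZero hf (circleMap 0 r θ)) using 2 with n
  have him : (coeff n (taylorSeriesAtZero f)).im = 0 := (Complex.nonneg_iff.1 (hp.1 n)).2.symm
  rw [Complex.mul_re, him, zero_mul, sub_zero, circleMap, zero_add, mul_pow, ← Complex.exp_nat_mul,
    ← mul_assoc (n : ℂ), ← Complex.ofReal_natCast, ← Complex.ofReal_mul, ← Complex.ofReal_pow,
    Complex.re_ofReal_mul, Complex.exp_ofReal_mul_I_re]

theorem hasSum_re (hf : Differentiable ℂ f) (hp : HasPosCoeff (taylorSeriesAtZero f))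
    (r : ℝ) : HasSum (fun n : ℕ => (coeff n (taylorSeriesAtZero f)).re * r ^ n) (f r).re := by
  simpa [circleMap] using hasSum_re_circleMap hf hp r 0

theorem re_lt_re_of_hasPosCoeff (hf : Differentiable ℂ f)
    (hp : HasPosCoeff (taylorSeriesAtZero f)) {r R : ℝ} (hr : 0 ≤ r) (hR : r < R) :
    (f r).re < (f R).re := by
  have h1 := sum_le_hasSum {2} (fun n _ => ?_) ((hasSum_re hf hp R).sub (hasSum_re hf hp r))
  · rw [Finset.sum_singleton, ← mul_sub] at h1
    have h2 : r ^ 2 < R ^ 2 := pow_lt_pow_left₀ hR hr two_ne_zero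
    have h3 := (Complex.pos_iff.1 (hp.2 2 le_rfl)).1
    nlinarith [mul_pos h3 (sub_pos.2 h2)]
  · have h2 : r ^ n ≤ R ^ n := pow_le_pow_left₀ hr hR.le n
    rw [← mul_sub]
    exact mul_nonneg (Complex.nonneg_iff.1 (hp.1 n)).1 (sub_nonneg.2 h2)

theorem re_circleMap_add_le_re (hf : Differentiable ℂ f)
    (hp : HasPosCoeff (taylorSeriesAtZero f)) {r : ℝ} (hr : 0 ≤ r) (θ : ℝ) :
    (f (circleMap 0 r θ)).re + ((coeff 2 (taylorSeriesAtZero f)).re * r ^ 2 *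
      (1 - Real.cos (2 * θ)) + (coeff 3 (taylorSeriesAtZero f)).re * r ^ 3 *
        (1 - Real.cos (3 * θ))) ≤ (f r).re := by
  have h1 := sum_le_hasSum {2, 3} (fun n _ => ?_)
    ((hasSum_re hf hp r).sub (hasSum_re_circleMap hf hp r θ))
  · rw [Finset.sum_pair (by norm_num)] at h1
    push_cast at h1
    linarith
  · have h2 := mul_nonneg (mul_nonneg (Complex.nonneg_iff.1 (hp.1 n)).1 (pow_nonneg hr n))
      (sub_nonneg.2 (Real.cos_le_one (n * θ)))
    linarith

theorem re_circleMap_le_re (hf : Differentiable ℂ f)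
    (hp : HasPosCoeff (taylorSeriesAtZero f)) {r : ℝ} (hr : 0 ≤ r) (θ : ℝ) :
    (f (circleMap 0 r θ)).re ≤ (f r).re := by
  have h := re_circleMap_add_le_re hf hp hr θ
  have h2 := mul_nonneg (mul_nonneg (Complex.nonneg_iff.1 (hp.1 2)).1 (pow_nonneg hr 2))
    (sub_nonneg.2 (Real.cos_le_one (2 * θ)))
  have h3 := mul_nonneg (mul_nonneg (Complex.nonneg_iff.1 (hp.1 3)).1 (pow_nonneg hr 3))
    (sub_nonneg.2 (Real.cos_le_one (3 * θ)))
  linarith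

theorem one_sub_cos_le (θ : ℝ) :
    1 - Real.cos θ ≤ 2 * ((1 - Real.cos (2 * θ)) + (1 - Real.cos (3 * θ))) := by
  rw [Real.cos_two_mul, Real.cos_three_mul]
  have h1 := Real.cos_le_one θ
  nlinarith [mul_nonneg (sub_nonneg.2 h1) (sq_nonneg (4 * Real.cos θ + 3))]

theorem exists_re_circleMap_le_re_sub (hf : Differentiable ℂ f)
    (hp : HasPosCoeff (taylorSeriesAtZero f)) {r : ℝ} (hr : 0 < r) :
    ∃ c > 0, ∀ θ, |θ| ≤ Real.pi → (f (circleMap 0 r θ)).re ≤ (f r).re - c * θ ^ 2 := by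
  have h2 := mul_pos (Complex.pos_iff.1 (hp.2 2 le_rfl)).1 (pow_pos hr 2)
  have h3 := mul_pos (Complex.pos_iff.1 (hp.2 3 (by norm_num))).1 (pow_pos hr 3)
  set A := (coeff 2 (taylorSeriesAtZero f)).re * r ^ 2
  set B := (coeff 3 (taylorSeriesAtZero f)).re * r ^ 3
  have hm : 0 < min A B := lt_min h2 h3
  refine ⟨min A B / 2 * (2 / Real.pi ^ 2), by positivity, fun θ hθ => ?_⟩
  have h := re_circleMap_add_le_re hf hp hr.le θ
  have h4 := sub_nonneg.2 (Real.cos_le_one (2 * θ))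
  have h5 := sub_nonneg.2 (Real.cos_le_one (3 * θ))
  have h6 := one_sub_cos_le θ
  have h7 := Real.cos_le_one_sub_mul_cos_sq hθ
  have h8 := mul_le_mul_of_nonneg_right (min_le_left A B) h4
  have h9 := mul_le_mul_of_nonneg_right (min_le_right A B) h5
  have h10 : 2 / Real.pi ^ 2 * θ ^ 2 ≤
      2 * ((1 - Real.cos (2 * θ)) + (1 - Real.cos (3 * θ))) := by linarith
  have h11 := mul_le_mul_of_nonneg_left h10 (half_pos hm).le
  change _ + (A * _ + B * _) ≤ _ at h
  linarith

end

end

section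

open PowerSeries
open scoped ComplexOrder

theorem taylorSeriesAtZero_congr {f g : ℂ → ℂ} (h : f =ᶠ[𝓝 0] g) :
    taylorSeriesAtZero f = taylorSeriesAtZero g := by
  ext n
  rw [coeff_taylorSeriesAtZero, coeff_taylorSeriesAtZero, h.iteratedDeriv_eq n]

/-- The generating function `w exp w` of rooted stars. -/
noncomputable def starFun : ℂ → ℂ := fun w => w * Complex.exp w

/-- The exponential of `starFun`. -/
noncomputable def starExpFun : ℂ → ℂ := fun w => Complex.exp (starFun w)

/-- The function `w (exp (w exp w) - 1)`. -/
noncomputable def doubleStarFun : ℂ → ℂ := fun w => w * (starExpFun w - 1)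

/-- The exponential generating function of the marked forests, in terms of the parameter `w`. -/
noncomputable def forestFun : ℂ → ℂ := fun w => Complex.exp
  (starFun w + doubleStarFun w - starFun w * (w * starExpFun w) - doubleStarFun w ^ 2 / 2)

theorem differentiable_starFun : Differentiable ℂ starFun := by
  unfold starFun; fun_prop

theorem differentiable_starExpFun : Differentiable ℂ starExpFun :=
  differentiable_starFun.cexp

theorem differentiable_doubleStarFun : Differentiable ℂ doubleStarFun :=
  differentiable_id.mul (differentiable_starExpFun.sub_const 1)

theorem differentiable_forestFun : Differentiable ℂ forestFun := by
  have := differentiable_starFun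
  have := differentiable_starExpFun
  have := differentiable_doubleStarFun
  unfold forestFun; fun_prop

theorem hasDerivAt_starFun (w : ℂ) : HasDerivAt starFun ((1 + w) * Complex.exp w) w := by
  convert! (hasDerivAt_id w).mul (Complex.hasDerivAt_exp w) using 1
  simp only [id]
  ring

theorem hasDerivAt_starExpFun (w : ℂ) :
    HasDerivAt starExpFun (deriv starFun w * starExpFun w) w := by
  convert! (differentiable_starFun w).hasDerivAt.cexp using 1
  rw [mul_comm]; rfl

theorem hasDerivAt_doubleStarFun (w : ℂ) : HasDerivAt doubleStarFun
    (starExpFun w - 1 + w * (deriv starFun w * starExpFun w)) w := by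
  convert! (hasDerivAt_id w).mul ((hasDerivAt_starExpFun w).sub_const 1) using 1
  simp only [id]
  ring

theorem mul_deriv_forestFun (w : ℂ) : w * deriv forestFun w =
    (starFun w + doubleStarFun w) * (1 - w * deriv doubleStarFun w) * forestFun w := by
  have h := ((((hasDerivAt_starFun w).add (hasDerivAt_doubleStarFun w)).sub
    ((hasDerivAt_starFun w).mul ((hasDerivAt_id w).mul (hasDerivAt_starExpFun w)))).sub
      (((hasDerivAt_doubleStarFun w).pow 2).div_const 2)).cexp
  have h' : deriv forestFun w = _ := h.deriv
  rw [h', (hasDerivAt_doubleStarFun w).deriv, (hasDerivAt_starFun w).deriv]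
  have hG : forestFun w = Complex.exp (starFun w + doubleStarFun w -
    starFun w * (w * starExpFun w) - doubleStarFun w ^ 2 / 2) := rfl
  simp only [Pi.add_apply, Pi.sub_apply, Pi.mul_apply, Pi.pow_apply, id]
  rw [← hG]
  generalize forestFun w = G
  simp only [doubleStarFun, starFun]
  push_cast
  ring

theorem taylorSeriesAtZero_exp_coeff_pos (n : ℕ) :
    0 < coeff n (taylorSeriesAtZero Complex.exp) := by
  rw [coeff_taylorSeriesAtZero, iteratedDeriv_eq_iterate, Complex.iter_deriv_exp, Complex.exp_zero]
  positivity

theorem taylorSeriesAtZero_starFun :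
    taylorSeriesAtZero starFun = X * taylorSeriesAtZero Complex.exp := by
  rw [← taylorSeriesAtZero_id]
  exact taylorSeriesAtZero_mul analyticAt_id (Complex.differentiable_exp.analyticAt 0)

theorem derivative_taylorSeriesAtZero_cexp {f : ℂ → ℂ} (hf : Differentiable ℂ f) :
    d⁄dX ℂ (taylorSeriesAtZero fun w => Complex.exp (f w)) =
      d⁄dX ℂ (taylorSeriesAtZero f) * taylorSeriesAtZero fun w => Complex.exp (f w) := by
  rw [← taylorSeriesAtZero_deriv, ← taylorSeriesAtZero_deriv,
    ← taylorSeriesAtZero_mul (hf.deriv.analyticAt 0) (hf.cexp.analyticAt 0)]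
  congr 1
  funext w
  rw [(hf w).hasDerivAt.cexp.deriv, mul_comm]
  rfl

theorem constantCoeff_taylorSeriesAtZero_starExpFun :
    constantCoeff (taylorSeriesAtZero starExpFun) = 1 := by
  rw [constantCoeff_taylorSeriesAtZero]
  simp [starExpFun, starFun]

theorem taylorSeriesAtZero_doubleStarFun :
    taylorSeriesAtZero doubleStarFun = X * (taylorSeriesAtZero starExpFun - 1) := by
  have h1 : taylorSeriesAtZero (fun _ => 1) = 1 := by rw [taylorSeriesAtZero_const, map_one]
  rw [← taylorSeriesAtZero_id, ← h1, ← taylorSeriesAtZero_sub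
    (differentiable_starExpFun.analyticAt 0) analyticAt_const]
  exact taylorSeriesAtZero_mul analyticAt_id
    ((differentiable_starExpFun.analyticAt 0).sub analyticAt_const)

theorem hasPosCoeff_starFun : HasPosCoeff (taylorSeriesAtZero starFun) := by
  rw [taylorSeriesAtZero_starFun]
  exact .X_mul taylorSeriesAtZero_exp_coeff_pos

theorem hasPosCoeff_doubleStarFun : HasPosCoeff (taylorSeriesAtZero doubleStarFun) := by
  rw [taylorSeriesAtZero_doubleStarFun]
  refine .X_mul_sub_one (coeff_pos_of_derivative_eq_mul
    (derivative_taylorSeriesAtZero_cexp differentiable_starFun) (fun n => ?_) ?_)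
    constantCoeff_taylorSeriesAtZero_starExpFun
  · rw [coeff_derivative, taylorSeriesAtZero_starFun, coeff_succ_X_mul]
    exact mul_pos (taylorSeriesAtZero_exp_coeff_pos n) (by positivity)
  · exact constantCoeff_taylorSeriesAtZero_starExpFun ▸ one_pos

theorem taylorSeriesAtZero_mul_deriv {f : ℂ → ℂ} (hf : AnalyticAt ℂ f 0) :
    taylorSeriesAtZero (fun w => w * deriv f w) = X * d⁄dX ℂ (taylorSeriesAtZero f) := by
  rw [← taylorSeriesAtZero_id, ← taylorSeriesAtZero_deriv]
  exact taylorSeriesAtZero_mul analyticAt_id hf.deriv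

/-- The saddle point. -/
theorem exists_mul_deriv_doubleStarFun_eq_one :
    ∃ τ : ℝ, 0 < τ ∧ (τ : ℂ) * deriv doubleStarFun τ = 1 := by
  set p : ℝ → ℝ := fun t => t * (Real.exp (t * Real.exp t) - 1 + t * ((1 + t) * Real.exp t *
    Real.exp (t * Real.exp t))) with hp
  have hpc : Continuous p := by fun_prop
  have h1 : 1 ≤ p 1 := by
    have h2 : 1 ≤ Real.exp 1 := Real.one_le_exp zero_le_one
    have h3 : 1 ≤ Real.exp (Real.exp 1) := Real.one_le_exp (Real.exp_pos 1).le
    have h4 := mul_le_mul h2 h3 zero_le_one (Real.exp_pos 1).le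
    simp only [hp, one_mul]
    nlinarith
  obtain ⟨τ, hτ, hpτ⟩ := intermediate_value_Icc zero_le_one hpc.continuousOn
    (show (1 : ℝ) ∈ Set.Icc (p 0) (p 1) from ⟨by simp [hp], h1⟩)
  refine ⟨τ, hτ.1.lt_of_ne fun h => ?_, ?_⟩
  · simp [hp, ← h] at hpτ
  · refine Eq.trans (b := ((p τ : ℝ) : ℂ)) ?_ (by rw [hpτ, Complex.ofReal_one])
    rw [(hasDerivAt_doubleStarFun _).deriv, (hasDerivAt_starFun _).deriv]
    simp only [hp, starExpFun, starFun]
    push_cast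
    ring

end

section

open PowerSeries
open scoped ComplexOrder

/-- A function whose derivative vanishes at the only zero `τ` of `1 - P` in a disc, where this zero
is simple, has derivative `q (1 - P)` with `q` holomorphic around the disc. -/
theorem exists_eq_mul_one_sub {D' P : ℂ → ℂ} (hD' : Differentiable ℂ D') (hP : Differentiable ℂ P)
    {τ : ℂ} (hD'τ : D' τ = 0) (hPτ : P τ = 1) (hP' : deriv P τ ≠ 0) {r : ℝ}
    (hne : ∀ w ∈ Metric.closedBall (0 : ℂ) r, w ≠ τ → P w ≠ 1) :
    ∃ (q : ℂ → ℂ) (U : Set ℂ), IsOpen U ∧ Metric.closedBall 0 r ⊆ U ∧ DifferentiableOn ℂ q U ∧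
      ∀ w ∈ U, D' w = q w * (1 - P w) := by
  have hslope : ∀ g : ℂ → ℂ, Differentiable ℂ g → Differentiable ℂ (dslope g τ) := fun g hg =>
    differentiableOn_univ.1 ((Complex.differentiableOn_dslope univ_mem).2 hg.differentiableOn)
  set p : ℂ → ℂ := dslope P τ with hp
  have hp' : Differentiable ℂ p := hslope P hP
  have hfac : ∀ w, P w - 1 = (w - τ) * p w := fun w => by
    have := sub_smul_dslope P τ w
    rw [hPτ, smul_eq_mul] at this
    exact this.symm
  refine ⟨fun w => -(dslope D' τ w / p w), {w | p w ≠ 0},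
    isOpen_ne_fun hp'.continuous continuous_const, fun w hw => ?_, ?_, fun w hw => ?_⟩
  · rcases eq_or_ne w τ with rfl | h
    · simpa [hp] using hP'
    · intro h0
      have := hfac w
      rw [h0, mul_zero, sub_eq_zero] at this
      exact hne w hw h this
  · exact ((hslope D' hD').differentiableOn.div hp'.differentiableOn fun w hw => hw).neg
  · have h1 := sub_smul_dslope D' τ w
    rw [hD'τ, sub_zero, smul_eq_mul] at h1
    have hw : p w ≠ 0 := hw
    rw [← h1, ← neg_sub (P w) 1, hfac]
    field_simp

theorem exists_tendsto_En_sub_mul :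
    ∃ (μ : ℝ) (l : ℂ), 0 < μ ∧
      Tendsto (fun m : ℕ => ((En (m + 1) - μ * (m + 1 : ℕ) : ℝ) : ℂ)) atTop (𝓝 l) := by
  obtain ⟨τ, hτ, hPτ⟩ := exists_mul_deriv_doubleStarFun_eq_one
  set ψ := doubleStarFun with hψdef
  set α := starFun with hαdef
  set G := forestFun with hGdef
  have hα : Differentiable ℂ α := differentiable_starFun
  have hψ : Differentiable ℂ ψ := differentiable_doubleStarFun
  have hG : Differentiable ℂ G := differentiable_forestFun
  have hα' : Differentiable ℂ (deriv α) := hα.deriv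
  have hψ' : Differentiable ℂ (deriv ψ) := hψ.deriv
  set P : ℂ → ℂ := fun w => w * deriv ψ w with hPdef
  have hP : Differentiable ℂ P := by fun_prop
  have hposP : HasPosCoeff (taylorSeriesAtZero P) := by
    rw [hPdef, taylorSeriesAtZero_mul_deriv (hψ.analyticAt 0)]
    exact hasPosCoeff_doubleStarFun.X_mul_derivative
  have hP'τ : 0 < deriv P τ := pos_of_hasPosCoeff hP.deriv
    (taylorSeriesAtZero_deriv P ▸ hposP.derivative) hτ
  have haτ : 0 < deriv α τ := pos_of_hasPosCoeff hα'
    (taylorSeriesAtZero_deriv α ▸ hasPosCoeff_starFun.derivative) hτ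
  have hcτ : 0 < deriv ψ τ := pos_of_hasPosCoeff hψ'
    (taylorSeriesAtZero_deriv ψ ▸ hasPosCoeff_doubleStarFun.derivative) hτ
  obtain ⟨a, ha, haeq⟩ : ∃ a : ℝ, 0 < a ∧ deriv α τ = a :=
    ⟨_, (Complex.pos_iff.1 haτ).1, Complex.ext rfl (Complex.pos_iff.1 haτ).2.symm⟩
  obtain ⟨c, hc, hceq⟩ : ∃ c : ℝ, 0 < c ∧ deriv ψ τ = c :=
    ⟨_, (Complex.pos_iff.1 hcτ).1, Complex.ext rfl (Complex.pos_iff.1 hcτ).2.symm⟩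
  set μ : ℝ := a / (a + c) with hμ
  set D : ℂ → ℂ := fun w => α w - μ * (α w + ψ w) with hD
  have hDd : Differentiable ℂ D := by fun_prop
  have hD' : ∀ w, deriv D w = deriv α w - μ * (deriv α w + deriv ψ w) := fun w =>
    ((hα w).hasDerivAt.sub (((hα w).hasDerivAt.add (hψ w).hasDerivAt).const_mul (μ : ℂ))).deriv
  have hD'τ : deriv D τ = 0 := by
    have h : (a : ℂ) + c ≠ 0 := by exact_mod_cast (add_pos ha hc).ne'
    rw [hD', haeq, hceq, hμ]
    push_cast
    field_simp
    ring
  have hne : ∀ w ∈ Metric.closedBall (0 : ℂ) τ, w ≠ τ → P w ≠ 1 := by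
    intro w hw hwτ h1
    have hcirc : circleMap 0 ‖w‖ w.arg = w := by
      rw [circleMap, zero_add, Complex.norm_mul_exp_arg_mul_I]
    rw [mem_closedBall_zero_iff] at hw
    have hPτ' : (P τ).re = 1 := by rw [hPdef]; simp only [hPτ, Complex.one_re]
    rcases hw.lt_or_eq with h | h
    · have h2 := re_circleMap_le_re hP hposP (norm_nonneg w) w.arg
      have h3 := re_lt_re_of_hasPosCoeff hP hposP (norm_nonneg w) h
      rw [hcirc, h1, Complex.one_re] at h2
      linarith
    · obtain ⟨b, hb, hle⟩ := exists_re_circleMap_le_re_sub hP hposP hτ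
      have h2 := hle w.arg (Complex.abs_arg_le_pi w)
      rw [← h, hcirc, h1, h, hPτ', Complex.one_re] at h2
      have h3 : w.arg = 0 := by
        have : w.arg ^ 2 ≤ 0 := by nlinarith
        exact pow_eq_zero_iff two_ne_zero |>.1 (le_antisymm this (sq_nonneg _))
      rw [h3, h] at hcirc
      exact hwτ (by rw [← hcirc]; simp [circleMap])
  obtain ⟨q, U, hU, hball, hq, hqeq⟩ := exists_eq_mul_one_sub hDd.deriv hP hD'τ hPτ hP'τ.ne' hne
  have hU0 : U ∈ 𝓝 (0 : ℂ) := hU.mem_nhds (hball (Metric.mem_closedBall_self hτ.le))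
  set H : ℂ → ℂ := fun w => D w * G w with hH
  set H₁ : ℂ → ℂ := fun w => w * q w * G w + D w * (α w + ψ w) * G w with hH₁
  have hHd : Differentiable ℂ H := hDd.mul hG
  have hH₁d : DifferentiableOn ℂ H₁ U :=
    ((differentiableOn_id.mul hq).mul hG.differentiableOn).add
      ((hDd.mul (hα.add hψ)).mul hG).differentiableOn
  have hH₁0 : AnalyticAt ℂ H₁ 0 := hH₁d.analyticAt hU0
  have hHH₁ : (fun w => w * deriv H w) =ᶠ[𝓝 0] ((fun _ => 1) - P) * H₁ := by
    filter_upwards [hU0] with w hw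
    have h1 : deriv H w = deriv D w * G w + D w * deriv G w :=
      ((hDd w).hasDerivAt.mul (hG w).hasDerivAt).deriv
    have h2 : w * deriv G w = (α w + ψ w) * (1 - P w) * G w := mul_deriv_forestFun w
    simp only [Pi.mul_apply, Pi.sub_apply]
    rw [h1, hqeq w hw, hH₁]
    linear_combination D w * h2
  obtain ⟨b, hb, hre⟩ := exists_re_circleMap_le_re_sub hψ hasPosCoeff_doubleStarFun hτ
  obtain ⟨A, hA⟩ := exists_tendsto_mul_coeff_taylorSeriesAtZero hψ hτ hPτ hb hre
    (Complex.pos_iff.1 (mul_pos (Complex.zero_lt_real.2 hτ) hP'τ)).1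
  set f₁ : ℂ → ℂ := fun w => w * deriv H₁ w with hf₁
  set S : ℂ → ℂ := fun w => (α w + ψ w) * G w with hS
  have hSd : Differentiable ℂ S := (hα.add hψ).mul hG
  set f₂ : ℂ → ℂ := fun w => w * deriv S w with hf₂
  have hf₁d : DifferentiableOn ℂ f₁ (Metric.closedBall 0 τ) :=
    (differentiableOn_id.mul (hH₁d.deriv hU)).mono hball
  have hf₂d : Differentiable ℂ f₂ := differentiable_id.mul hSd.deriv
  have hf₂τ : f₂ τ ≠ 0 := by
    have h1 : deriv S τ = (deriv α τ + deriv ψ τ) * G τ + (α τ + ψ τ) * deriv G τ :=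
      (((hα _).hasDerivAt.add (hψ _).hasDerivAt).mul (hG _).hasDerivAt).deriv
    have h2 : (τ : ℂ) * deriv G τ = 0 := by
      rw [hGdef, mul_deriv_forestFun, hPτ, sub_self, mul_zero, zero_mul]
    have h3 : f₂ τ = τ * (deriv α τ + deriv ψ τ) * G τ := by
      rw [hf₂]
      simp only [h1]
      linear_combination (α τ + ψ τ) * h2
    rw [h3]
    refine mul_ne_zero (mul_ne_zero ?_ (add_pos haτ hcτ).ne') (Complex.exp_ne_zero _)
    exact_mod_cast hτ.ne'
  have ht : Tendsto (fun n : ℕ => n + 1) atTop atTop := tendsto_add_atTop_nat 1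
  have hlim₁ := (hA f₁ hf₁d).comp ht
  have hlim₂ := (hA f₂ hf₂d.differentiableOn).comp ht
  refine ⟨μ, f₁ τ / f₂ τ, div_pos ha (add_pos ha hc), ?_⟩
  refine (hlim₁.div hlim₂ hf₂τ).congr' ?_
  filter_upwards [hlim₂.eventually_ne hf₂τ] with m hm
  simp only [Function.comp_apply] at hm
  have hA0 : A (m + 1) ≠ 0 := left_ne_zero_of_mul hm
  have hc0 := right_ne_zero_of_mul hm
  have hφ : ∀ n : ℕ, ∀ f : ℂ → ℂ, AnalyticAt ℂ f 0 →
      taylorSeriesAtZero (fun w => w * deriv f w * Complex.exp (ψ w) ^ n) =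
        X * d⁄dX ℂ (taylorSeriesAtZero f) *
          (taylorSeriesAtZero fun w => Complex.exp (ψ w)) ^ n := by
    intro n f hf
    rw [← taylorSeriesAtZero_mul_deriv hf, ← taylorSeriesAtZero_pow (hψ.cexp.analyticAt 0)]
    exact taylorSeriesAtZero_mul (analyticAt_id.mul hf.deriv) ((hψ.cexp.analyticAt 0).pow n)
  have hTS : taylorSeriesAtZero S =
      (taylorSeriesAtZero α + taylorSeriesAtZero ψ) * taylorSeriesAtZero G := by
    rw [← taylorSeriesAtZero_add (hα.analyticAt 0) (hψ.analyticAt 0)]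
    exact taylorSeriesAtZero_mul ((hα.add hψ).analyticAt 0) (hG.analyticAt 0)
  have hT1 : taylorSeriesAtZero ((fun _ => 1) - P) =
      1 - X * d⁄dX ℂ (taylorSeriesAtZero ψ) := by
    rw [taylorSeriesAtZero_sub analyticAt_const (hP.analyticAt 0), taylorSeriesAtZero_const,
      map_one, taylorSeriesAtZero_mul_deriv (hψ.analyticAt 0)]
  have h1P : AnalyticAt ℂ ((fun _ => 1) - P) 0 := analyticAt_const.sub (hP.analyticAt 0)
  have hX := hφ (m + 1) S (hSd.analyticAt 0)
  rw [hTS] at hX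
  simp only [Pi.div_apply, Function.comp_apply]
  rw [hf₂] at hc0 ⊢
  rw [hX] at hc0 ⊢
  rw [hf₁, hφ (m + 1) H₁ hH₁0, mul_div_mul_left _ _ hA0]
  have key := En_sub_mul_coeff (e := taylorSeriesAtZero Complex.exp)
    (α := taylorSeriesAtZero α) (ε := taylorSeriesAtZero starExpFun) (ψ := taylorSeriesAtZero ψ)
    (φ := taylorSeriesAtZero fun w => Complex.exp (ψ w)) (G := taylorSeriesAtZero G)
    (H := taylorSeriesAtZero H) (H₁ := taylorSeriesAtZero H₁)
    (by rw [← taylorSeriesAtZero_deriv, Complex.deriv_exp])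
    (by rw [constantCoeff_taylorSeriesAtZero, Complex.exp_zero])
    taylorSeriesAtZero_starFun (derivative_taylorSeriesAtZero_cexp hα)
    constantCoeff_taylorSeriesAtZero_starExpFun taylorSeriesAtZero_doubleStarFun
    (derivative_taylorSeriesAtZero_cexp hψ)
    (by rw [constantCoeff_taylorSeriesAtZero]; simp [hψdef, doubleStarFun])
    (by
      rw [← hT1, ← taylorSeriesAtZero_add (hα.analyticAt 0) (hψ.analyticAt 0),
        ← taylorSeriesAtZero_mul ((hα.add hψ).analyticAt 0) h1P,
        ← taylorSeriesAtZero_mul (((hα.add hψ).analyticAt 0).mul h1P) (hG.analyticAt 0),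
        ← taylorSeriesAtZero_mul_deriv (hG.analyticAt 0)]
      congr 1
      funext w
      exact mul_deriv_forestFun w)
    (by
      rw [constantCoeff_taylorSeriesAtZero]
      simp [hGdef, forestFun, starFun, doubleStarFun]) μ
    (by
      rw [← taylorSeriesAtZero_add (hα.analyticAt 0) (hψ.analyticAt 0),
        ← taylorSeriesAtZero_smul _ ((hα.add hψ).analyticAt 0),
        ← taylorSeriesAtZero_sub (hα.analyticAt 0) (((hα.add hψ).const_smul _).analyticAt 0)]
      exact taylorSeriesAtZero_mul (hDd.analyticAt 0) (hG.analyticAt 0))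
    (by
      rw [← hT1, ← taylorSeriesAtZero_mul h1P hH₁0,
        ← taylorSeriesAtZero_mul_deriv (hHd.analyticAt 0)]
      exact taylorSeriesAtZero_congr hHH₁) m hc0
  rw [← key]

end

theorem stmt_11 :
    ∃ μ K : ℝ, 0 < μ ∧ 0 ≤ K ∧
      ∀ n : ℕ, 1 ≤ n → |En n - μ * (n : ℝ)| ≤ K := by
  obtain ⟨μ, l, hμ, hl⟩ := exists_tendsto_En_sub_mul
  obtain ⟨K, hK⟩ := (Metric.isBounded_range_of_tendsto _ hl).exists_norm_le
  refine ⟨μ, K, hμ, (norm_nonneg _).trans (hK _ ⟨0, rfl⟩), fun n hn => ?_⟩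
  obtain ⟨m, rfl⟩ : ∃ m, n = m + 1 := ⟨n - 1, by omega⟩
  have := hK _ ⟨m, rfl⟩
  rwa [Complex.norm_real] at this
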